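/- arXiv:2410.04483 — 2 statements merged into one kernel-verified Lean document; each statement's English description precedes it below -/
import Mathlib

section
/- Let γ ∈ [0,1), q ∈ [1,∞), and let (u,v) be a pair of nonnegative measurable functions on ℝ^{n+1} with u^q locally integrable. Then (u,v) ∈ TA_{1,q}⁺(γ) if and only if there exists a constant C ∈ (0,∞) such that M_0^{γ−}(u^q)(x,t) ≤ C·(v(x,t))^q for almost every (x,t) ∈ ℝ^{n+1}. -/
open MeasureTheory ENNReal NNReal Set

noncomputable section

/-- The `γ`-upper part `R⁺(γ)` of the parabolic rectangle `R(x,t,L)`. -/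
def parUp (n : ℕ) (p : ℝ) (x : Fin n → ℝ) (t L γ : ℝ) : Set ((Fin n → ℝ) × ℝ) :=
  {z : (Fin n → ℝ) × ℝ | ‖z.1 - x‖ ≤ L ∧ z.2 ∈ Set.Ioo (t + γ * L ^ p) (t + L ^ p)}

/-- The `γ`-lower part `R⁻(γ)` of the parabolic rectangle `R(x,t,L)`. -/
def parLow (n : ℕ) (p : ℝ) (x : Fin n → ℝ) (t L γ : ℝ) : Set ((Fin n → ℝ) × ℝ) :=
  {z : (Fin n → ℝ) × ℝ | ‖z.1 - x‖ ≤ L ∧ z.2 ∈ Set.Ioo (t - L ^ p) (t - γ * L ^ p)}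

/-- The integral average `⨍_A f`, valued in `ℝ≥0∞`. -/
def setAvg {n : ℕ} (A : Set ((Fin n → ℝ) × ℝ)) (f : ((Fin n → ℝ) × ℝ) → ℝ≥0∞) : ℝ≥0∞ :=
  (∫⁻ z in A, f z) / volume A

/-- The backward-in-time translate `A − (0, a)`. -/
def timeShift {n : ℕ} (A : Set ((Fin n → ℝ) × ℝ)) (a : ℝ) : Set ((Fin n → ℝ) × ℝ) :=
  {z : (Fin n → ℝ) × ℝ | (z.1, z.2 + a) ∈ A}

/-- `[u,v]_{TA_{r,q}^+(γ)}` for `1 < r ≤ q`. -/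
def TArq (n : ℕ) (p γ r q : ℝ) (u v : ((Fin n → ℝ) × ℝ) → ℝ) : ℝ≥0∞ :=
  ⨆ (x : Fin n → ℝ) (t : ℝ) (L : ℝ) (_ : 0 < L),
    setAvg (parLow n p x t L γ) (fun z => ENNReal.ofReal (u z) ^ q) *
      (setAvg (parUp n p x t L γ)
          (fun z => ENNReal.ofReal (v z) ^ (-(r / (r - 1))))) ^ (q / (r / (r - 1)))

/-- `[u,v]_{TA_{1,q}^+(γ)}`. -/
def TA1q (n : ℕ) (p γ q : ℝ) (u v : ((Fin n → ℝ) × ℝ) → ℝ) : ℝ≥0∞ :=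
  ⨆ (x : Fin n → ℝ) (t : ℝ) (L : ℝ) (_ : 0 < L),
    setAvg (parLow n p x t L γ) (fun z => ENNReal.ofReal (u z) ^ q) *
      (essInf (fun z => ENNReal.ofReal (v z)) (volume.restrict (parUp n p x t L γ))) ^ (-q)

/-- The `TA_{r,q}^+(γ)` constant, for all `1 ≤ r ≤ q`. -/
def TAconst (n : ℕ) (p γ r q : ℝ) (u v : ((Fin n → ℝ) × ℝ) → ℝ) : ℝ≥0∞ :=
  if r = 1 then TA1q n p γ q u v else TArq n p γ r q u v

/-- `[u,v]_{TA_{r,q}^-(γ)}` (time axis reversed), for `1 < r ≤ q`. -/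
def TArqMinus (n : ℕ) (p γ r q : ℝ) (u v : ((Fin n → ℝ) × ℝ) → ℝ) : ℝ≥0∞ :=
  ⨆ (x : Fin n → ℝ) (t : ℝ) (L : ℝ) (_ : 0 < L),
    setAvg (parUp n p x t L γ) (fun z => ENNReal.ofReal (u z) ^ q) *
      (setAvg (parLow n p x t L γ)
          (fun z => ENNReal.ofReal (v z) ^ (-(r / (r - 1))))) ^ (q / (r / (r - 1)))

/-- The parabolic Muckenhoupt `A_q^+(γ)` constant. -/
def parAq (n : ℕ) (p γ q : ℝ) (w : ((Fin n → ℝ) × ℝ) → ℝ) : ℝ≥0∞ :=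
  ⨆ (x : Fin n → ℝ) (t : ℝ) (L : ℝ) (_ : 0 < L),
    setAvg (parLow n p x t L γ) (fun z => ENNReal.ofReal (w z)) *
      (setAvg (parUp n p x t L γ) (fun z => ENNReal.ofReal (w z) ^ (1 / (1 - q)))) ^ (q - 1)

/-- Membership in `A_∞^+(γ) := ⋃_{q ∈ (1,∞)} A_q^+(γ)`. -/
def memAinf (n : ℕ) (p γ : ℝ) (w : ((Fin n → ℝ) × ℝ) → ℝ) : Prop :=
  ∃ q : ℝ, 1 < q ∧ parAq n p γ q w < ∞

/-- The uncentered forward-in-time parabolic fractional maximal function `M_β^{γ+} f`. -/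
def uMax (n : ℕ) (p γ β : ℝ) (f : ((Fin n → ℝ) × ℝ) → ℝ) (z : (Fin n → ℝ) × ℝ) : ℝ≥0∞ :=
  ⨆ (x : Fin n → ℝ) (t : ℝ) (L : ℝ) (_ : 0 < L) (_ : z ∈ parLow n p x t L γ),
    volume (parUp n p x t L γ) ^ β *
      setAvg (parUp n p x t L γ) (fun w => ENNReal.ofReal |f w|)

/-- The uncentered back-in-time parabolic fractional maximal function `M_β^{γ−} f`. -/
def uMaxBack (n : ℕ) (p γ β : ℝ) (f : ((Fin n → ℝ) × ℝ) → ℝ) (z : (Fin n → ℝ) × ℝ) : ℝ≥0∞ :=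
  ⨆ (x : Fin n → ℝ) (t : ℝ) (L : ℝ) (_ : 0 < L) (_ : z ∈ parUp n p x t L γ),
    volume (parLow n p x t L γ) ^ β *
      setAvg (parLow n p x t L γ) (fun w => ENNReal.ofReal |f w|)

/-- The centered forward-in-time parabolic fractional maximal function `𝓜_β^{γ+} f`. -/
def cMax (n : ℕ) (p γ β : ℝ) (f : ((Fin n → ℝ) × ℝ) → ℝ) (z : (Fin n → ℝ) × ℝ) : ℝ≥0∞ :=
  ⨆ (L : ℝ) (_ : 0 < L),
    volume (parUp n p z.1 z.2 L γ) ^ β *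
      setAvg (parUp n p z.1 z.2 L γ) (fun w => ENNReal.ofReal |f w|)

/-- `‖f‖_{L^r(ℝ^{n+1}, w^r)}` as a lintegral. -/
def wLp {n : ℕ} (r : ℝ) (w f : ((Fin n → ℝ) × ℝ) → ℝ) : ℝ≥0∞ :=
  (∫⁻ z, ENNReal.ofReal |f z| ^ r * ENNReal.ofReal (w z) ^ r) ^ (1 / r)

/-- The weighted `L^q(w^q)` norm of an `ℝ≥0∞`-valued function. -/
def wLpE {n : ℕ} (q : ℝ) (w : ((Fin n → ℝ) × ℝ) → ℝ)
    (g : ((Fin n → ℝ) × ℝ) → ℝ≥0∞) : ℝ≥0∞ :=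
  (∫⁻ z, g z ^ q * ENNReal.ofReal (w z) ^ q) ^ (1 / q)

/-- The weighted weak `L^{q,∞}(w^q)` norm of an `ℝ≥0∞`-valued function. -/
def wWeak {n : ℕ} (q : ℝ) (w : ((Fin n → ℝ) × ℝ) → ℝ)
    (g : ((Fin n → ℝ) × ℝ) → ℝ≥0∞) : ℝ≥0∞ :=
  ⨆ (lam : ℝ≥0) (_ : 0 < lam),
    (lam : ℝ≥0∞) * (∫⁻ z in {z | (lam : ℝ≥0∞) < g z}, ENNReal.ofReal (w z) ^ q) ^ (1 / q)

/-- The parabolic forward-in-time fractional integral `I_β^{γ+} f` (unsigned version). -/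
def parI (n : ℕ) (p γ β : ℝ) (f : ((Fin n → ℝ) × ℝ) → ℝ) (z : (Fin n → ℝ) × ℝ) : ℝ≥0∞ :=
  ∫⁻ w in {w : (Fin n → ℝ) × ℝ | γ * ‖w.1‖ ^ p < w.2},
    ENNReal.ofReal (f (z.1 - w.1, z.2 - w.2) *
      (max ‖w.1‖ (|w.2| ^ (1 / p))) ^ (-(((n : ℝ) + p) * (1 - β))))

/-- The parabolic forward-in-time fractional integral `I_β^{γ+} f` (signed version). -/
def parIR (n : ℕ) (p γ β : ℝ) (f : ((Fin n → ℝ) × ℝ) → ℝ) (z : (Fin n → ℝ) × ℝ) : ℝ :=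
  ∫ w in {w : (Fin n → ℝ) × ℝ | γ * ‖w.1‖ ^ p < w.2},
    f (z.1 - w.1, z.2 - w.2) * (max ‖w.1‖ (|w.2| ^ (1 / p))) ^ (-(((n : ℝ) + p) * (1 - β)))

lemma aux_low_eq (n : ℕ) (p : ℝ) (x : Fin n → ℝ) (t L γ : ℝ) :
    parLow n p x t L γ = Metric.closedBall x L ×ˢ Set.Ioo (t - L ^ p) (t - γ * L ^ p) := by
  ext z
  simp [parLow, dist_eq_norm]

lemma aux_up_eq (n : ℕ) (p : ℝ) (x : Fin n → ℝ) (t L γ : ℝ) :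
    parUp n p x t L γ = Metric.closedBall x L ×ˢ Set.Ioo (t + γ * L ^ p) (t + L ^ p) := by
  ext z
  simp [parUp, dist_eq_norm]

lemma aux_vol (n : ℕ) (p : ℝ) (x : Fin n → ℝ) (t L γ : ℝ) (hL : 0 ≤ L) :
    volume (parLow n p x t L γ) = ENNReal.ofReal ((2 * L) ^ n * (L ^ p - γ * L ^ p)) := by
  rw [aux_low_eq, Measure.volume_eq_prod, Measure.prod_prod, Real.volume_pi_closedBall x hL,
    Real.volume_Ioo, ← ENNReal.ofReal_mul (by positivity)]
  congr 1
  simp only [Fintype.card_fin]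
  ring

lemma aux_low_meas (n : ℕ) (p : ℝ) (x : Fin n → ℝ) (t L γ : ℝ) :
    MeasurableSet (parLow n p x t L γ) := by
  rw [aux_low_eq]
  exact measurableSet_closedBall.prod measurableSet_Ioo

lemma aux_up_meas (n : ℕ) (p : ℝ) (x : Fin n → ℝ) (t L γ : ℝ) :
    MeasurableSet (parUp n p x t L γ) := by
  rw [aux_up_eq]
  exact measurableSet_closedBall.prod measurableSet_Ioo

lemma aux_vol_ne (n : ℕ) (p : ℝ) (x : Fin n → ℝ) (t L γ : ℝ) (hL : 0 < L) (hγ : γ < 1) :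
    volume (parLow n p x t L γ) ≠ 0 ∧ volume (parLow n p x t L γ) ≠ ∞ := by
  rw [aux_vol n p x t L γ hL.le]
  refine ⟨?_, ENNReal.ofReal_ne_top⟩
  have h1 : 0 < L ^ p := Real.rpow_pos_of_pos hL p
  have h2 : 0 < L ^ p - γ * L ^ p := by nlinarith
  have : 0 < (2 * L) ^ n * (L ^ p - γ * L ^ p) := by positivity
  simpa using this

/-- Fatou: if each point of `A` is eventually in `B k`. -/
lemma aux_fatou {n : ℕ} (A : Set ((Fin n → ℝ) × ℝ)) (B : ℕ → Set ((Fin n → ℝ) × ℝ))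
    (hA : MeasurableSet A) (hB : ∀ k, MeasurableSet (B k))
    (h : ∀ z ∈ A, ∀ᶠ k in Filter.atTop, z ∈ B k)
    (f : ((Fin n → ℝ) × ℝ) → ℝ≥0∞) (hf : Measurable f) :
    ∫⁻ z in A, f z ≤ Filter.liminf (fun k => ∫⁻ z in B k, f z) Filter.atTop := by
  have e : ∀ k, ∫⁻ z in B k, f z = ∫⁻ z, (B k).indicator f z :=
    fun k => (lintegral_indicator (hB k) f).symm
  simp only [e]
  rw [← lintegral_indicator hA]
  refine le_trans (lintegral_mono ?_) (lintegral_liminf_le (fun k => hf.indicator (hB k)))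
  intro z
  by_cases hz : z ∈ A
  · rw [Set.indicator_of_mem hz]
    refine Filter.le_liminf_of_le (by isBoundedDefault) ?_
    filter_upwards [h z hz] with k hk
    rw [Set.indicator_of_mem hk]
  · rw [Set.indicator_of_notMem hz]
    exact zero_le

/-- Approximation of a triple by a sequence in a dense set. -/
lemma aux_seq {n : ℕ} (D : Set ((Fin n → ℝ) × ℝ × ℝ)) (hD : Dense D)
    (x : Fin n → ℝ) (t L : ℝ) :
    ∃ d : ℕ → (Fin n → ℝ) × ℝ × ℝ, (∀ k, d k ∈ D) ∧ (∀ k, ‖(d k).1 - x‖ < (d k).2.2 - L) ∧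
      Filter.Tendsto d Filter.atTop (nhds (x, t, L)) := by
  set W : Set ((Fin n → ℝ) × ℝ × ℝ) := {d | ‖d.1 - x‖ < d.2.2 - L} with hW
  have hWo : IsOpen W := isOpen_lt (by fun_prop) (by fun_prop)
  have h1 : (x, t, L) ∈ closure W := by
    rw [mem_closure_iff_seq_limit]
    refine ⟨fun k => (x, t, L + 1 / ((k : ℝ) + 1)), fun k => ?_, ?_⟩
    · simp only [hW, Set.mem_setOf_eq, sub_self, norm_zero]
      have : (0 : ℝ) < 1 / ((k : ℝ) + 1) := by positivity
      linarith
    · refine Filter.Tendsto.prodMk_nhds tendsto_const_nhds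
        (Filter.Tendsto.prodMk_nhds tendsto_const_nhds ?_)
      simpa using (tendsto_const_nhds (x := L)).add tendsto_one_div_add_atTop_nhds_zero_nat
  have h2 : (x, t, L) ∈ closure (W ∩ D) := by
    have := hD.open_subset_closure_inter hWo
    exact closure_minimal this isClosed_closure h1
  obtain ⟨d, hd, hd'⟩ := mem_closure_iff_seq_limit.1 h2
  exact ⟨d, fun k => (hd k).2, fun k => (hd k).1, hd'⟩

/-- Key approximation step. -/
lemma aux_approx (n : ℕ) (p γ : ℝ) (hp : 1 < p) (hγ : γ < 1)
    (D : Set ((Fin n → ℝ) × ℝ × ℝ)) (hD : Dense D)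
    (f : ((Fin n → ℝ) × ℝ) → ℝ≥0∞) (hf : Measurable f) (z : (Fin n → ℝ) × ℝ) (c : ℝ≥0∞)
    (hc : c ≠ ∞)
    (h : ∀ d ∈ D, 0 < d.2.2 → z ∈ parUp n p d.1 d.2.1 d.2.2 γ →
      setAvg (parLow n p d.1 d.2.1 d.2.2 γ) f ≤ c)
    (x : Fin n → ℝ) (t L : ℝ) (hL : 0 < L) (hz : z ∈ parUp n p x t L γ) :
    setAvg (parLow n p x t L γ) f ≤ c := by
  obtain ⟨d, hdD, hdW, hd⟩ := aux_seq D hD x t L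
  have ht : Filter.Tendsto (fun k => (d k).2.1) Filter.atTop (nhds t) :=
    ((continuous_fst.comp continuous_snd).tendsto (x, t, L)).comp hd
  have hl : Filter.Tendsto (fun k => (d k).2.2) Filter.atTop (nhds L) :=
    ((continuous_snd.comp continuous_snd).tendsto (x, t, L)).comp hd
  have hlp : Filter.Tendsto (fun k => (d k).2.2 ^ p) Filter.atTop (nhds (L ^ p)) :=
    hl.rpow_const (Or.inl hL.ne')
  have hLk : ∀ k, L < (d k).2.2 := fun k => by
    have := hdW k
    have := norm_nonneg ((d k).1 - x)
    linarith
  have hsp : ∀ k, ∀ y : Fin n → ℝ, ‖y - x‖ ≤ L → ‖y - (d k).1‖ ≤ (d k).2.2 := fun k y hy => by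
    have h1 := hdW k
    have h2 : y - (d k).1 = (y - x) - ((d k).1 - x) := by abel
    rw [h2]
    have := norm_sub_le (y - x) ((d k).1 - x)
    linarith
  have hup : ∀ᶠ k in Filter.atTop, z ∈ parUp n p (d k).1 (d k).2.1 (d k).2.2 γ := by
    filter_upwards [(ht.add (hlp.const_mul γ)).eventually_lt_const hz.2.1,
      (ht.add hlp).eventually_const_lt hz.2.2] with k h1 h2
    exact ⟨hsp k _ hz.1, h1, h2⟩
  have hlow : ∀ w ∈ parLow n p x t L γ,
      ∀ᶠ k in Filter.atTop, w ∈ parLow n p (d k).1 (d k).2.1 (d k).2.2 γ := by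
    intro w hw
    filter_upwards [(ht.sub (hlp.const_mul γ)).eventually_const_lt hw.2.2,
      (ht.sub hlp).eventually_lt_const hw.2.1] with k h1 h2
    exact ⟨hsp k _ hw.1, h2, h1⟩
  have hF := aux_fatou _ _ (aux_low_meas n p x t L γ)
    (fun k => aux_low_meas n p (d k).1 (d k).2.1 (d k).2.2 γ) hlow f hf
  have hvol : Filter.Tendsto (fun k => volume (parLow n p (d k).1 (d k).2.1 (d k).2.2 γ))
      Filter.atTop (nhds (volume (parLow n p x t L γ))) := by
    rw [aux_vol n p x t L γ hL.le]
    have e : ∀ k, volume (parLow n p (d k).1 (d k).2.1 (d k).2.2 γ) = _ :=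
      fun k => aux_vol n p (d k).1 (d k).2.1 (d k).2.2 γ (hL.trans (hLk k)).le
    simp only [e]
    exact ENNReal.tendsto_ofReal (((hl.const_mul 2).pow n).mul (hlp.sub (hlp.const_mul γ)))
  have hcv : Filter.Tendsto (fun k => c * volume (parLow n p (d k).1 (d k).2.1 (d k).2.2 γ))
      Filter.atTop (nhds (c * volume (parLow n p x t L γ))) :=
    ENNReal.Tendsto.const_mul hvol (Or.inr hc)
  have hv := aux_vol_ne n p x t L γ hL hγ
  unfold setAvg
  rw [ENNReal.div_le_iff hv.1 hv.2]
  refine hF.trans ?_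
  rw [← hcv.liminf_eq]
  refine Filter.liminf_le_liminf ?_
  filter_upwards [hup] with k hk
  have hvk := aux_vol_ne n p (d k).1 (d k).2.1 (d k).2.2 γ (hL.trans (hLk k)) hγ
  have := h (d k) (hdD k) (hL.trans (hLk k)) hk
  unfold setAvg at this
  rwa [ENNReal.div_le_iff hvk.1 hvk.2] at this

lemma aux_mul_le {a e K : ℝ≥0∞} {q : ℝ} (hq : 0 < q) (hK : K ≠ ∞) (h : a * e ^ (-q) ≤ K) :
    a ≤ (K + 1) * e ^ q := by
  rw [ENNReal.rpow_neg] at h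
  rcases eq_or_ne (e ^ q) 0 with h0 | h0
  · rw [h0, ENNReal.inv_zero] at h
    have : a = 0 := by
      by_contra ha
      rw [ENNReal.mul_top ha] at h
      exact hK (top_le_iff.1 h)
    simp [this]
  rcases eq_or_ne (e ^ q) ∞ with h1 | h1
  · rw [h1, ENNReal.mul_top (by simp)]
    exact le_top
  · rw [← div_eq_mul_inv, ENNReal.div_le_iff h0 h1] at h
    exact h.trans (by gcongr; exact le_self_add)

lemma aux_le_mul {a e C : ℝ≥0∞} {q : ℝ} (h : a ≤ C * e ^ q) :
    a * e ^ (-q) ≤ C := by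
  rw [ENNReal.rpow_neg]
  rcases eq_or_ne (e ^ q) 0 with h0 | h0
  · rw [h0, mul_zero] at h
    simp [le_antisymm h zero_le]
  rcases eq_or_ne (e ^ q) ∞ with h1 | h1
  · simp [h1]
  · rwa [← div_eq_mul_inv, ENNReal.div_le_iff h0 h1]

/-- Characterization of `TA_{1,q}^+(γ)` via the uncentered back-in-time parabolic
maximal operator `M_0^{γ−}`. -/
theorem TA1q_iff_uMaxBack (n : ℕ) (hn : 1 ≤ n) (p : ℝ) (hp : 1 < p)
    (γ : ℝ) (hγ : γ ∈ Set.Ico (0 : ℝ) 1) (q : ℝ) (hq : 1 ≤ q)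
    (u v : ((Fin n → ℝ) × ℝ) → ℝ) (hu : Measurable u) (hv : Measurable v)
    (hu0 : ∀ z, 0 ≤ u z) (hv0 : ∀ z, 0 ≤ v z)
    (huq : LocallyIntegrable (fun z => u z ^ q) volume) :
    TA1q n p γ q u v < ∞ ↔
      ∃ C : ℝ, 0 < C ∧ ∀ᵐ z : (Fin n → ℝ) × ℝ ∂volume,
        uMaxBack n p γ 0 (fun w => u w ^ q) z ≤
          ENNReal.ofReal C * ENNReal.ofReal (v z) ^ q := by
  have hq0 : 0 < q := by linarith
  have hf : Measurable (fun z => ENNReal.ofReal (u z) ^ q) := by fun_prop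
  have hfe : (fun w => ENNReal.ofReal |u w ^ q|) = fun z => ENNReal.ofReal (u z) ^ q := by
    funext z
    rw [abs_of_nonneg (Real.rpow_nonneg (hu0 z) q),
      ENNReal.ofReal_rpow_of_nonneg (hu0 z) hq0.le]
  constructor
  · intro hK
    set K := TA1q n p γ q u v with hKdef
    refine ⟨(K + 1).toReal, ?_, ?_⟩
    · exact ENNReal.toReal_pos (by simp) (by simp [hK.ne])
    rw [ENNReal.ofReal_toReal (by simp [hK.ne])]
    obtain ⟨D, hDc, hDd⟩ := TopologicalSpace.exists_countable_dense ((Fin n → ℝ) × ℝ × ℝ)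
    have hae : ∀ᵐ z : (Fin n → ℝ) × ℝ ∂volume, ∀ d ∈ D, 0 < d.2.2 →
        z ∈ parUp n p d.1 d.2.1 d.2.2 γ →
        setAvg (parLow n p d.1 d.2.1 d.2.2 γ) (fun z => ENNReal.ofReal (u z) ^ q)
          ≤ (K + 1) * ENNReal.ofReal (v z) ^ q := by
      rw [ae_ball_iff hDc]
      intro d _
      have h1 := (ae_restrict_iff' (aux_up_meas n p d.1 d.2.1 d.2.2 γ)).1
        (ae_essInf_le (f := fun z => ENNReal.ofReal (v z))
          (μ := volume.restrict (parUp n p d.1 d.2.1 d.2.2 γ)))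
      filter_upwards [h1] with z hz hL hzm
      have h2 : setAvg (parLow n p d.1 d.2.1 d.2.2 γ) (fun z => ENNReal.ofReal (u z) ^ q) *
          (essInf (fun z => ENNReal.ofReal (v z))
            (volume.restrict (parUp n p d.1 d.2.1 d.2.2 γ))) ^ (-q) ≤ K := by
        rw [hKdef]
        unfold TA1q
        exact le_iSup_of_le d.1 (le_iSup_of_le d.2.1 (le_iSup_of_le d.2.2
          (le_iSup_of_le hL le_rfl)))
      refine (aux_mul_le hq0 hK.ne h2).trans ?_
      gcongr
      exact hz hzm
    filter_upwards [hae] with z hz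
    unfold uMaxBack
    refine iSup_le fun x => iSup_le fun t => iSup_le fun L => iSup_le fun hL =>
      iSup_le fun hzm => ?_
    rw [ENNReal.rpow_zero, one_mul, hfe]
    refine aux_approx n p γ hp hγ.2 D hDd _ hf z _ ?_ hz x t L hL hzm
    exact ENNReal.mul_ne_top (by simp [hK.ne])
      (ENNReal.rpow_ne_top_of_nonneg hq0.le ENNReal.ofReal_ne_top)
  · rintro ⟨C, hC, hae⟩
    refine lt_of_le_of_lt ?_ (ENNReal.ofReal_lt_top (r := C))
    unfold TA1q
    refine iSup_le fun x => iSup_le fun t => iSup_le fun L => iSup_le fun hL => ?_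
    apply aux_le_mul
    set a := setAvg (parLow n p x t L γ) (fun z => ENNReal.ofReal (u z) ^ q) with ha
    have hC0 : ENNReal.ofReal C ≠ 0 := by simpa using hC
    have hkey : (a / ENNReal.ofReal C) ^ (1 / q) ≤
        essInf (fun z => ENNReal.ofReal (v z)) (volume.restrict (parUp n p x t L γ)) := by
      refine le_essInf_of_ae_le _ ?_ (by isBoundedDefault)
      refine (ae_restrict_iff' (aux_up_meas n p x t L γ)).2 ?_
      filter_upwards [hae] with z hz hzm
      have h1 : a ≤ ENNReal.ofReal C * ENNReal.ofReal (v z) ^ q := by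
        refine le_trans ?_ hz
        unfold uMaxBack
        refine le_iSup_of_le x (le_iSup_of_le t (le_iSup_of_le L
          (le_iSup_of_le hL (le_iSup_of_le hzm ?_))))
        rw [ENNReal.rpow_zero, one_mul, hfe]
      rw [one_div, ENNReal.rpow_inv_le_iff hq0]
      exact ENNReal.div_le_of_le_mul' h1
    rw [one_div, ENNReal.rpow_inv_le_iff hq0,
      ENNReal.div_le_iff hC0 ENNReal.ofReal_ne_top] at hkey
    rwa [mul_comm]
end
end

section
/- Let β ∈ [0,1), 1 ≤ r ≤ q < ∞ with β = 1/r − 1/q, and let (u,v) be a pair of nonnegative measurable functions on ℝ^{n+1}. Then (u,v) ∈ TA_{r,q}⁺(0) if and only if M_β^{0+} is bounded from L^r(ℝ^{n+1}, v^r) to L^{q,∞}(ℝ^{n+1}, u^q), i.e., there exists a positive constant C such that ‖M_β^{0+}(f)‖_{L^{q,∞}(ℝ^{n+1},u^q)} ≤ C ‖f‖_{L^r(ℝ^{n+1},v^r)} for every f ∈ L^r(ℝ^{n+1}, v^r). -/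
open MeasureTheory ENNReal NNReal Set

noncomputable section

theorem mem_parUp0 {n : ℕ} {p : ℝ} {x : Fin n → ℝ} {t L : ℝ} {w : (Fin n → ℝ) × ℝ} :
    w ∈ parUp n p x t L 0 ↔ ‖w.1 - x‖ ≤ L ∧ t < w.2 ∧ w.2 < t + L ^ p := by
  simp [parUp]

theorem mem_parLow0 {n : ℕ} {p : ℝ} {x : Fin n → ℝ} {t L : ℝ} {w : (Fin n → ℝ) × ℝ} :
    w ∈ parLow n p x t L 0 ↔ ‖w.1 - x‖ ≤ L ∧ t - L ^ p < w.2 ∧ w.2 < t := by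
  simp [parLow]

theorem parUp0_eq (n : ℕ) (p : ℝ) (x : Fin n → ℝ) (t L : ℝ) :
    parUp n p x t L 0 = Metric.closedBall x L ×ˢ Ioo t (t + L ^ p) := by
  ext w
  simp [mem_parUp0, dist_eq_norm]

theorem parLow0_eq (n : ℕ) (p : ℝ) (x : Fin n → ℝ) (t L : ℝ) :
    parLow n p x t L 0 = Metric.closedBall x L ×ˢ Ioo (t - L ^ p) t := by
  ext w
  simp [mem_parLow0, dist_eq_norm]

theorem measurableSet_parUp0 (n : ℕ) (p : ℝ) (x : Fin n → ℝ) (t L : ℝ) :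
    MeasurableSet (parUp n p x t L 0) := by
  rw [parUp0_eq]
  exact Metric.isClosed_closedBall.measurableSet.prod measurableSet_Ioo

theorem measurableSet_parLow0 (n : ℕ) (p : ℝ) (x : Fin n → ℝ) (t L : ℝ) :
    MeasurableSet (parLow n p x t L 0) := by
  rw [parLow0_eq]
  exact Metric.isClosed_closedBall.measurableSet.prod measurableSet_Ioo

/-- Common volume of the upper and lower parts. -/
def pVol (n : ℕ) (p L : ℝ) : ℝ≥0∞ := ENNReal.ofReal ((2 * L) ^ n * L ^ p)

theorem volume_parUp0 (n : ℕ) (p : ℝ) (x : Fin n → ℝ) (t L : ℝ) (hL : 0 < L) :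
    volume (parUp n p x t L 0) = pVol n p L := by
  rw [parUp0_eq, Measure.volume_eq_prod, Measure.prod_prod, Real.volume_pi_closedBall _ hL.le,
    Real.volume_Ioo, pVol, ENNReal.ofReal_mul (by positivity)]
  simp

theorem volume_parLow0 (n : ℕ) (p : ℝ) (x : Fin n → ℝ) (t L : ℝ) (hL : 0 < L) :
    volume (parLow n p x t L 0) = pVol n p L := by
  rw [parLow0_eq, Measure.volume_eq_prod, Measure.prod_prod, Real.volume_pi_closedBall _ hL.le,
    Real.volume_Ioo, pVol, ENNReal.ofReal_mul (by positivity)]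
  simp

theorem pVol_ne_top (n : ℕ) (p L : ℝ) : pVol n p L ≠ ∞ := ENNReal.ofReal_ne_top

theorem pVol_ne_zero (n : ℕ) (p L : ℝ) (hL : 0 < L) : pVol n p L ≠ 0 := by
  have : 0 < (2 * L) ^ n * L ^ p := by positivity
  simpa [pVol] using this

theorem pVol_scale (n : ℕ) (p c L : ℝ) (hc : 0 < c) (hL : 0 < L) :
    pVol n p (c * L) = ENNReal.ofReal (c ^ n * c ^ p) * pVol n p L := by
  rw [pVol, pVol, ← ENNReal.ofReal_mul (by positivity), Real.mul_rpow hc.le hL.le]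
  congr 1
  ring

/-- The scale factor. -/
def kap (n : ℕ) (p s c : ℝ) : ℝ≥0∞ := ENNReal.ofReal (c ^ n * c ^ p) ^ s

theorem kap_ne_top (n : ℕ) (p s c : ℝ) (hs : 0 ≤ s) : kap n p s c ≠ ∞ :=
  ENNReal.rpow_ne_top_of_nonneg hs ENNReal.ofReal_ne_top

theorem kap_ne_zero (n : ℕ) (p s c : ℝ) (hc : 0 < c) : kap n p s c ≠ 0 := by
  have h : 0 < c ^ n * c ^ p := by positivity
  have : ENNReal.ofReal (c ^ n * c ^ p) ≠ 0 := (ENNReal.ofReal_pos.2 h).ne'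
  intro h0
  rw [kap, ENNReal.rpow_eq_zero_iff] at h0
  rcases h0 with h0 | h0
  · exact this h0.1
  · exact ENNReal.ofReal_ne_top h0.1

theorem pVol_rpow_scale (n : ℕ) (p s c L : ℝ) (hs : 0 ≤ s) (hc : 0 < c) (hL : 0 < L) :
    pVol n p (c * L) ^ s = kap n p s c * pVol n p L ^ s := by
  rw [pVol_scale n p c L hc hL, ENNReal.mul_rpow_of_nonneg _ _ hs, kap]

theorem pVol_rpow_ne_zero (n : ℕ) (p s L : ℝ) (hL : 0 < L) : pVol n p L ^ s ≠ 0 := by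
  intro h0
  rw [ENNReal.rpow_eq_zero_iff] at h0
  have := pVol_ne_zero n p L hL
  have := pVol_ne_top n p L
  simp_all

theorem pVol_rpow_ne_top (n : ℕ) (p s L : ℝ) (hL : 0 < L) : pVol n p L ^ s ≠ ∞ := by
  intro h0
  rw [ENNReal.rpow_eq_top_iff] at h0
  have := pVol_ne_zero n p L hL
  have := pVol_ne_top n p L
  simp_all

/-- The median in time of the mass of `g` on an upper part. -/
theorem exists_median {n : ℕ} {p : ℝ} (g : ((Fin n → ℝ) × ℝ) → ℝ≥0∞)
    (hgi : ∫⁻ z, g z ≠ ∞) (x : Fin n → ℝ) (s L : ℝ) (hL : 0 < L) :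
    ∃ τ ∈ Icc s (s + L ^ p),
      ∫⁻ z in Metric.closedBall x L ×ˢ Ioc s τ, g z = (∫⁻ z in parUp n p x s L 0, g z) / 2 ∧
      ∫⁻ z in Metric.closedBall x L ×ˢ Ioo τ (s + L ^ p), g z
        = (∫⁻ z in parUp n p x s L 0, g z) / 2 := by
  set e := s + L ^ p with he
  have hse : s ≤ e := by
    have : 0 < L ^ p := by positivity
    linarith
  set μ : Measure ((Fin n → ℝ) × ℝ) := volume.withDensity g with hμ
  have : IsFiniteMeasure μ := ⟨by simpa [hμ] using hgi.lt_top⟩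
  set Q := Metric.closedBall x L with hQ
  have hQm : MeasurableSet Q := Metric.isClosed_closedBall.measurableSet
  set ν : Measure ℝ := (μ.restrict (Q ×ˢ univ)).map Prod.snd with hν
  have hνapp : ∀ S : Set ℝ, MeasurableSet S → ν S = ∫⁻ z in Q ×ˢ S, g z := by
    intro S hS
    rw [hν, Measure.map_apply measurable_snd hS, Measure.restrict_apply (measurable_snd hS), hμ,
      withDensity_apply]
    · congr 2
      ext w
      simp [and_comm]
    · exact (measurable_snd hS).inter (hQm.prod MeasurableSet.univ)
  have hν0 : ∀ τ : ℝ, ν {τ} = 0 := by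
    intro τ
    rw [hνapp _ (measurableSet_singleton τ)]
    apply setLIntegral_measure_zero
    rw [Measure.volume_eq_prod, Measure.prod_prod]
    simp
  have : NullSingletonClass ν := ⟨hν0⟩
  have hcont : Continuous fun b => ∫ _x in s..b, (1 : ℝ) ∂ν :=
    intervalIntegral.continuous_primitive (fun a b => intervalIntegrable_const) s
  have hval : ∀ b, s ≤ b → ∫ _x in s..b, (1 : ℝ) ∂ν = (ν (Ioc s b)).toReal := by
    intro b hb
    rw [intervalIntegral.integral_of_le hb]
    simp [Measure.real]
  have htot : ν (Ioc s e) = ∫⁻ z in parUp n p x s L 0, g z := by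
    rw [parUp0_eq, ← hνapp _ measurableSet_Ioo]
    exact (measure_congr Ioo_ae_eq_Ioc).symm
  have hm : (ν (Ioc s e)).toReal / 2 ∈ Icc (∫ _x in s..s, (1 : ℝ) ∂ν) (∫ _x in s..e, (1 : ℝ) ∂ν) := by
    rw [hval e hse]
    simp only [intervalIntegral.integral_same]
    have : 0 ≤ (ν (Ioc s e)).toReal := ENNReal.toReal_nonneg
    constructor <;> linarith
  obtain ⟨τ, hτ, hτv⟩ := intermediate_value_Icc hse hcont.continuousOn hm
  have hfin : ∀ S, ν S ≠ ∞ := fun S => measure_ne_top ν S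
  have h1 : ν (Ioc s τ) = ν (Ioc s e) / 2 := by
    have h := hτv
    simp only [hval τ hτ.1] at h
    rw [← ENNReal.toReal_eq_toReal_iff' (hfin _) (ENNReal.div_ne_top (hfin _) (by simp)), h]
    simp
  have h2 : ν (Ioc τ e) = ν (Ioc s e) / 2 := by
    have hun : ν (Ioc s e) = ν (Ioc s τ) + ν (Ioc τ e) := by
      rw [← Ioc_union_Ioc_eq_Ioc hτ.1 hτ.2, measure_union _ measurableSet_Ioc]
      exact Set.disjoint_left.2 fun a ha hb => absurd ha.2 (not_le.2 hb.1)
    have h3 : ν (Ioc s e) / 2 + ν (Ioc τ e) = ν (Ioc s e) / 2 + ν (Ioc s e) / 2 := by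
      rw [ENNReal.add_halves]
      conv_rhs => rw [hun]
      rw [h1]
    exact (ENNReal.add_right_inj (ENNReal.div_ne_top (hfin _) (by simp))).1 h3
  refine ⟨τ, hτ, ?_, ?_⟩
  · rw [← hνapp _ measurableSet_Ioc, h1, htot]
  · rw [← hνapp _ measurableSet_Ioo, measure_congr Ioo_ae_eq_Ioc, h2, htot]


theorem good_bounded (n : ℕ) (p s : ℝ) (hp : 1 < p) (hs : 0 < s) (a I : ℝ≥0∞)
    (ha0 : a ≠ 0) (hI : I ≠ ∞) :
    ∃ R : ℝ, ∀ L : ℝ, 0 < L → a * pVol n p L ^ s < I → L ≤ R := by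
  refine ⟨max 1 ((I / a) ^ (1 / s)).toReal, fun L hL h => ?_⟩
  by_cases h1 : L ≤ 1
  · exact h1.trans (le_max_left _ _)
  push Not at h1
  refine le_trans ?_ (le_max_right _ _)
  have h2 : ENNReal.ofReal L ≤ pVol n p L := by
    apply ENNReal.ofReal_le_ofReal
    have e1 : (1 : ℝ) ≤ (2 * L) ^ n := one_le_pow₀ (by linarith)
    have e2 : L ≤ L ^ p := by
      conv_lhs => rw [← Real.rpow_one L]
      exact Real.rpow_le_rpow_of_exponent_le h1.le hp.le
    nlinarith
  have hat : a ≠ ∞ := by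
    rintro rfl
    rw [ENNReal.top_mul (pVol_rpow_ne_zero n p s L hL)] at h
    exact not_top_lt h
  have hfin : I / a ≠ ∞ := ENNReal.div_ne_top hI ha0
  have h3 : ENNReal.ofReal L ^ s ≤ I / a := by
    rw [ENNReal.le_div_iff_mul_le (Or.inl ha0) (Or.inl hat), mul_comm]
    refine le_trans ?_ h.le
    gcongr
  have h4 : ENNReal.ofReal L ≤ (I / a) ^ (1 / s) := by
    rw [one_div, ENNReal.le_rpow_inv_iff hs]
    exact h3
  have h5 : (I / a) ^ (1 / s) ≠ ∞ := ENNReal.rpow_ne_top_of_nonneg (by positivity) hfin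
  exact (ENNReal.ofReal_le_iff_le_toReal h5).1 h4

theorem three_rpow {p L : ℝ} (hp : 1 < p) (hL : 0 < L) :
    L ^ p + (2 * L) ^ p ≤ (3 * L) ^ p := by
  have := Real.add_rpow_le_rpow_add hL.le (by positivity : (0 : ℝ) ≤ 2 * L) hp.le
  have e : L + 2 * L = 3 * L := by ring
  rwa [e] at this

theorem five_rpow {p L : ℝ} (hp : 1 < p) (hL : 0 < L) :
    3 * L ^ p < (5 * L) ^ p := by
  rw [Real.mul_rpow (by norm_num) hL.le]
  have h : (5 : ℝ) ≤ 5 ^ p := by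
    conv_lhs => rw [← Real.rpow_one (5 : ℝ)]
    exact Real.rpow_le_rpow_of_exponent_le (by norm_num) hp.le
  have : 0 < L ^ p := by positivity
  nlinarith

theorem cover_lemma (n : ℕ) (p s : ℝ) (hp : 1 < p) (hs : 0 < s)
    (g : ((Fin n → ℝ) × ℝ) → ℝ≥0∞) (hg : Measurable g) (hgi : ∫⁻ z, g z ≠ ∞)
    (a : ℝ≥0∞) (ha0 : a ≠ 0) (hat : a ≠ ∞) :
    ∃ (u : Set ((Fin n → ℝ) × ℝ)) (l τ : ((Fin n → ℝ) × ℝ) → ℝ)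
      (F : ((Fin n → ℝ) × ℝ) → Set ((Fin n → ℝ) × ℝ)),
      u.Countable ∧ (∀ b ∈ u, 0 < l b) ∧ (∀ b ∈ u, MeasurableSet (F b)) ∧
      (∀ b ∈ u, F b ⊆ parUp n p b.1 (τ b) (3 * l b) 0) ∧
      ({z | ∃ L : ℝ, 0 < L ∧ a * pVol n p L ^ s < ∫⁻ w in parUp n p z.1 z.2 L 0, g w} ⊆
        ⋃ b ∈ u, parLow n p b.1 (τ b) (3 * l b) 0) ∧
      (∀ b ∈ u, a * pVol n p (l b) ^ s ≤ 4 * ∫⁻ w in F b, g w) ∧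
      ∀ w, ∑' b : u, (F b).indicator (fun _ => (1 : ℝ≥0∞)) w ≤ 4 * kap n p s 5 := by
  classical
  set E := {z : (Fin n → ℝ) × ℝ | ∃ L : ℝ, 0 < L ∧
    a * pVol n p L ^ s < ∫⁻ w in parUp n p z.1 z.2 L 0, g w} with hE
  obtain ⟨R, hR⟩ := good_bounded n p s hp hs a _ ha0 hgi
  have hR' : ∀ z : (Fin n → ℝ) × ℝ, ∀ L : ℝ, 0 < L →
      a * pVol n p L ^ s < ∫⁻ w in parUp n p z.1 z.2 L 0, g w → L ≤ R := fun z L hL h =>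
    hR L hL (h.trans_le (setLIntegral_le_lintegral _ _))
  -- almost maximal sizes
  have hch : ∀ z : (Fin n → ℝ) × ℝ, ∃ L : ℝ, 0 < L ∧ (z ∈ E →
      (a * pVol n p L ^ s < ∫⁻ w in parUp n p z.1 z.2 L 0, g w) ∧
      ∀ L', 2 * L ≤ L' → ∫⁻ w in parUp n p z.1 z.2 L' 0, g w ≤ a * pVol n p L' ^ s) := by
    intro z
    by_cases hz : z ∈ E
    · set S := {L : ℝ | 0 < L ∧ a * pVol n p L ^ s < ∫⁻ w in parUp n p z.1 z.2 L 0, g w} with hS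
      have hne : S.Nonempty := hz
      have hbd : BddAbove S := ⟨R, fun L hL => hR' z L hL.1 hL.2⟩
      have hpos : 0 < sSup S := by
        obtain ⟨L, hL⟩ := hne
        exact hL.1.trans_le (le_csSup hbd hL)
      obtain ⟨L, hL, hlt⟩ := exists_lt_of_lt_csSup hne (half_lt_self hpos)
      refine ⟨L, hL.1, fun _ => ⟨hL.2, fun L' hL' => ?_⟩⟩
      by_contra hcon
      push Not at hcon
      have hmem : L' ∈ S := ⟨by linarith [hL.1], hcon⟩
      have := le_csSup hbd hmem
      linarith
    · exact ⟨1, one_pos, fun h => absurd h hz⟩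
  choose l hlpos hl using hch
  -- medians
  have hmed := fun z : (Fin n → ℝ) × ℝ => exists_median (p := p) g hgi z.1 z.2 (l z) (hlpos z)
  choose τ hτ hD hG using hmed
  set D : ((Fin n → ℝ) × ℝ) → Set ((Fin n → ℝ) × ℝ) :=
    fun z => Metric.closedBall z.1 (l z) ×ˢ Ioc z.2 (τ z) with hDdef
  set G : ((Fin n → ℝ) × ℝ) → Set ((Fin n → ℝ) × ℝ) :=
    fun z => Metric.closedBall z.1 (l z) ×ˢ Ioo (τ z) (z.2 + l z ^ p) with hGdef
  have hDm : ∀ z, MeasurableSet (D z) := fun z =>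
    Metric.isClosed_closedBall.measurableSet.prod measurableSet_Ioc
  have hGm : ∀ z, MeasurableSet (G z) := fun z =>
    Metric.isClosed_closedBall.measurableSet.prod measurableSet_Ioo
  have hDmem : ∀ z w, w ∈ D z ↔ ‖w.1 - z.1‖ ≤ l z ∧ z.2 < w.2 ∧ w.2 ≤ τ z := by
    intro z w
    simp [hDdef, dist_eq_norm]
  have hGmem : ∀ z w, w ∈ G z ↔ ‖w.1 - z.1‖ ≤ l z ∧ τ z < w.2 ∧ w.2 < z.2 + l z ^ p := by
    intro z w
    simp [hGdef, dist_eq_norm]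
  have hDG : ∀ z, ∫⁻ w in D z, g w = ∫⁻ w in G z, g w := fun z => (hD z).trans (hG z).symm
  have hτlt : ∀ z ∈ E, z.2 < τ z := by
    intro z hz
    by_contra hcon
    have h0 := hD z
    rw [Ioc_eq_empty hcon] at h0
    simp only [prod_empty, Measure.restrict_empty, lintegral_zero_measure] at h0
    have h1 := (hl z hz).1
    have h2 := ENNReal.div_eq_zero_iff.1 h0.symm
    rcases h2 with h2 | h2
    · rw [h2] at h1
      exact _root_.not_lt_zero h1
    · simp at h2
  obtain ⟨u, huE, hdis, hcov⟩ := Vitali.exists_disjoint_subfamily_covering_enlargement D E l 2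
    one_lt_two (fun z _ => (hlpos z).le) R (fun z hz => hR' z _ (hlpos z) (hl z hz).1)
    (fun z hz => ⟨(z.1, τ z), (hDmem _ _).2 ⟨by simpa using (hlpos z).le, hτlt z hz, le_rfl⟩⟩)
  have hcount : u.Countable := by
    apply hdis.countable_of_nonempty_interior
    intro z hz
    have hsub : Metric.ball z.1 (l z) ×ˢ Ioo z.2 (τ z) ⊆ interior (D z) :=
      interior_maximal (prod_mono Metric.ball_subset_closedBall Ioo_subset_Ioc_self)
        (Metric.isOpen_ball.prod isOpen_Ioo)
    refine Set.Nonempty.mono hsub ((Metric.nonempty_ball.2 (hlpos z)).prod ?_)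
    exact nonempty_Ioo.2 (hτlt z (huE hz))
  have : Countable u := hcount.to_subtype
  set N := 4 * kap n p s 5 with hN
  set S : ((Fin n → ℝ) × ℝ) → ((Fin n → ℝ) × ℝ) → ℝ≥0∞ := fun b w =>
    ∑' P : u, if l P ≤ l b then (G P).indicator (fun _ => (1 : ℝ≥0∞)) w else 0 with hS
  have hSm : ∀ b, Measurable (S b) := by
    intro b
    refine Measurable.tsum fun P => ?_
    split_ifs
    · exact measurable_const.indicator (hGm P)
    · exact measurable_const
  set F : ((Fin n → ℝ) × ℝ) → Set ((Fin n → ℝ) × ℝ) := fun b => G b ∩ {w | S b w ≤ N} with hF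
  have hFm : ∀ b, MeasurableSet (F b) := fun b =>
    (hGm b).inter (measurableSet_le (hSm b) measurable_const)
  -- the packing estimate
  have hpack : ∀ b ∈ u, ∫⁻ w in G b, g w * S b w ≤ kap n p s 5 * (a * pVol n p (l b) ^ s) := by
    intro b hb
    have e1 : ∫⁻ w in G b, g w * S b w = ∑' P : u,
        ∫⁻ w in G b, g w * (if l P ≤ l b then (G P).indicator (fun _ => (1 : ℝ≥0∞)) w else 0) := by
      rw [← lintegral_tsum]
      · refine lintegral_congr fun w => ?_
        rw [hS, ENNReal.tsum_mul_left]
      · intro P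
        refine (hg.mul ?_).aemeasurable
        split_ifs
        · exact measurable_const.indicator (hGm P)
        · exact measurable_const
    rw [e1, ENNReal.tsum_eq_iSup_sum]
    refine iSup_le fun T => ?_
    set T' := T.filter (fun P : u => l P ≤ l b ∧ (G P ∩ G b).Nonempty) with hT'
    have e2 : ∑ P ∈ T, ∫⁻ w in G b, g w *
          (if l P ≤ l b then (G P).indicator (fun _ => (1 : ℝ≥0∞)) w else 0)
        ≤ ∑ P ∈ T', ∫⁻ w in D P, g w := by
      rw [hT', Finset.sum_filter]
      refine Finset.sum_le_sum fun P _ => ?_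
      by_cases hP : l P ≤ l b
      · by_cases hPG : (G P ∩ G b).Nonempty
        · simp only [hP, hPG, and_self, if_true]
          rw [hDG P, ← lintegral_indicator (hGm P)]
          refine (setLIntegral_le_lintegral _ _).trans (lintegral_mono fun w => ?_)
          by_cases hw : w ∈ G P <;> simp [hw]
        · simp only [hP, hPG, and_false, if_true, if_false]
          rw [nonpos_iff_eq_zero]
          refine setLIntegral_eq_zero (hGm b) fun w hw => ?_
          have : w ∉ G P := fun hw' => hPG ⟨w, hw', hw⟩
          simp [this]
      · simp [hP]
    refine e2.trans ?_
    rcases T'.eq_empty_or_nonempty with hem | hnem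
    · simp [hem]
    obtain ⟨P0, hP0, hmin⟩ := T'.exists_min_image (fun P : u => (P : (Fin n → ℝ) × ℝ).2) hnem
    have e3 : ∑ P ∈ T', ∫⁻ w in D P, g w = ∫⁻ w in ⋃ P ∈ T', D P, g w := by
      rw [lintegral_biUnion_finset]
      · intro P _ P' _ hne
        exact hdis P.2 P'.2 (fun h => hne (Subtype.ext h))
      · exact fun P _ => hDm P
    rw [e3]
    have hsub : (⋃ P ∈ T', D P) ⊆ parUp n p P0.1.1 P0.1.2 (5 * l b) 0 := by
      intro w hw
      simp only [mem_iUnion] at hw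
      obtain ⟨P, hP, hwP⟩ := hw
      obtain ⟨hw1, hw2, hw3⟩ := (hDmem _ _).1 hwP
      obtain ⟨-, hlP, c, hcP, hcb⟩ := Finset.mem_filter.1 hP
      obtain ⟨-, hlP0, c0, hcP0, hcb0⟩ := Finset.mem_filter.1 hP0
      obtain ⟨a1, a2, a3⟩ := (hGmem _ _).1 hcP
      obtain ⟨b1, b2, b3⟩ := (hGmem _ _).1 hcb
      obtain ⟨c1, c2, c3⟩ := (hGmem _ _).1 hcP0
      obtain ⟨d1, d2, d3⟩ := (hGmem _ _).1 hcb0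
      have hpw : l P ^ p ≤ l b ^ p := Real.rpow_le_rpow (hlpos _).le hlP (by linarith)
      have hpw0 : l P0 ^ p ≤ l b ^ p := Real.rpow_le_rpow (hlpos _).le hlP0 (by linarith)
      have h5 := five_rpow hp (hlpos b)
      have hm := hmin P hP
      have t1 := hτ P
      have t0 := hτ P0
      have tb := hτ b
      simp only [mem_Icc] at t1 t0 tb
      refine mem_parUp0.2 ⟨?_, by linarith, by linarith⟩
      have hsplit : w.1 - P0.1.1 = (w.1 - P.1.1) - (c.1 - P.1.1) + (c.1 - b.1) - (c0.1 - b.1)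
          + (c0.1 - P0.1.1) := by abel
      rw [hsplit]
      have n1 := norm_add_le ((w.1 - P.1.1) - (c.1 - P.1.1) + (c.1 - b.1) - (c0.1 - b.1))
        (c0.1 - P0.1.1)
      have n2 := norm_sub_le ((w.1 - P.1.1) - (c.1 - P.1.1) + (c.1 - b.1)) (c0.1 - b.1)
      have n3 := norm_add_le ((w.1 - P.1.1) - (c.1 - P.1.1)) (c.1 - b.1)
      have n4 := norm_sub_le (w.1 - P.1.1) (c.1 - P.1.1)
      linarith
    have hlP0 := (Finset.mem_filter.1 hP0).2.1
    calc ∫⁻ w in ⋃ P ∈ T', D P, g w ≤ ∫⁻ w in parUp n p P0.1.1 P0.1.2 (5 * l b) 0, g w :=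
          lintegral_mono_set hsub
      _ ≤ a * pVol n p (5 * l b) ^ s :=
          (hl P0 (huE P0.2)).2 _ (by linarith [hlpos b])
      _ = kap n p s 5 * (a * pVol n p (l b) ^ s) := by
          rw [pVol_rpow_scale n p s 5 (l b) hs.le (by norm_num) (hlpos b)]
          ring
  refine ⟨u, l, τ, F, hcount, fun b _ => hlpos b, fun b _ => hFm b, ?_, ?_, ?_, ?_⟩
  · intro b _ w hw
    obtain ⟨h1, h2, h3⟩ := (hGmem _ _).1 hw.1
    have t := hτ b
    have h4 := three_rpow hp (hlpos b)
    have h5 : 0 < (2 * l b) ^ p := Real.rpow_pos_of_pos (by linarith [hlpos b]) _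
    exact mem_parUp0.2 ⟨by linarith [hlpos b], h2, by linarith [t.1]⟩
  · intro z hz
    obtain ⟨b, hb, ⟨c, hcz, hcb⟩, hlz⟩ := hcov z hz
    obtain ⟨a1, a2, a3⟩ := (hDmem _ _).1 hcz
    obtain ⟨b1, b2, b3⟩ := (hDmem _ _).1 hcb
    simp only [mem_iUnion]
    refine ⟨b, hb, mem_parLow0.2 ⟨?_, ?_, by linarith⟩⟩
    · have hsplit : z.1 - b.1 = (c.1 - b.1) - (c.1 - z.1) := by abel
      rw [hsplit]
      have := norm_sub_le (c.1 - b.1) (c.1 - z.1)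
      linarith
    · have hpw : l z ^ p ≤ (2 * l b) ^ p := Real.rpow_le_rpow (hlpos _).le hlz (by linarith)
      have h4 := three_rpow hp (hlpos b)
      have tz := (hτ z).2
      have tb := (hτ b).2
      linarith
  · intro b hb
    set W := a * pVol n p (l b) ^ s with hW
    have hk0 := kap_ne_zero n p s 5 (by norm_num)
    have hkt := kap_ne_top n p s 5 hs.le
    have hWt : W ≠ ∞ := ENNReal.mul_ne_top hat (pVol_rpow_ne_top n p s _ (hlpos b))
    have h1 : W / 2 ≤ ∫⁻ w in G b, g w := by
      rw [hG b]
      exact ENNReal.div_le_div_right (hl b (huE hb)).1.le _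
    have h2 : ∫⁻ w in G b, g w = (∫⁻ w in F b, g w) + ∫⁻ w in G b \ {w | S b w ≤ N}, g w := by
      exact (lintegral_inter_add_sdiff _ _ (measurableSet_le (hSm b) measurable_const)).symm
    have h3 : N * ∫⁻ w in G b \ {w | S b w ≤ N}, g w ≤ kap n p s 5 * W := by
      refine le_trans ?_ (hpack b hb)
      rw [← lintegral_const_mul _ hg]
      refine le_trans ?_ (lintegral_mono_set (sdiff_subset (t := {w | S b w ≤ N})))
      refine setLIntegral_mono (hg.mul (hSm b)) fun w hw => ?_
      rw [mul_comm]
      have : N ≤ S b w := (not_le.1 hw.2).le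
      gcongr
    have h4 : 4 * ∫⁻ w in G b \ {w | S b w ≤ N}, g w ≤ W := by
      refine (ENNReal.mul_le_mul_iff_right hk0 hkt).1 (le_trans (le_of_eq ?_) h3)
      rw [hN]
      ring
    have h5 : W + W ≤ (4 * ∫⁻ w in F b, g w) + W := by
      calc W + W = 4 * (W / 2) := by
            rw [show (4 : ℝ≥0∞) = 2 * 2 by norm_num, mul_assoc,
              ENNReal.mul_div_cancel (by simp) (by simp), two_mul]
        _ ≤ 4 * ((∫⁻ w in F b, g w) + ∫⁻ w in G b \ {w | S b w ≤ N}, g w) := by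
            rw [← h2]
            gcongr
        _ ≤ _ := by
            rw [mul_add]
            gcongr
    exact (ENNReal.add_le_add_iff_right hWt).1 h5
  · intro w
    rw [ENNReal.tsum_eq_iSup_sum]
    refine iSup_le fun T => ?_
    set T' := T.filter (fun P : u => w ∈ F P) with hT'
    have e1 : ∑ b ∈ T, (F b).indicator (fun _ => (1 : ℝ≥0∞)) w = ∑ b ∈ T', 1 := by
      rw [hT', Finset.sum_filter]
      refine Finset.sum_congr rfl fun P _ => ?_
      by_cases hw : w ∈ F P <;> simp [hw]
    rw [e1]
    rcases T'.eq_empty_or_nonempty with hem | hnem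
    · simp [hem]
    obtain ⟨b0, hb0, hmax⟩ := T'.exists_max_image (fun P : u => l P) hnem
    have hwb : w ∈ F b0 := (Finset.mem_filter.1 hb0).2
    refine le_trans ?_ (show S b0 w ≤ N from hwb.2)
    refine le_trans ?_ (ENNReal.sum_le_tsum T')
    refine Finset.sum_le_sum fun P hP => ?_
    have hwP : w ∈ G P := (Finset.mem_filter.1 hP).2.1
    simp [hmax P hP, hwP]


theorem tsum_rpow_le_rpow_tsum {ι : Type*} (X : ι → ℝ≥0∞) (s : ℝ) (hs : 1 ≤ s) :
    ∑' i, X i ^ s ≤ (∑' i, X i) ^ s := by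
  have hsplit : ∀ x : ℝ≥0∞, x ^ s = x ^ (s - 1) * x := by
    intro x
    conv_lhs => rw [show s = (s - 1) + 1 by ring]
    rw [ENNReal.rpow_add_of_nonneg _ _ (by linarith) zero_le_one, ENNReal.rpow_one]
  calc ∑' i, X i ^ s ≤ ∑' i, (∑' j, X j) ^ (s - 1) * X i := by
        refine ENNReal.tsum_le_tsum fun i => ?_
        rw [hsplit]
        exact mul_le_mul_left (ENNReal.rpow_le_rpow (ENNReal.le_tsum i) (by linarith)) _
    _ = _ := by rw [ENNReal.tsum_mul_left, ← hsplit]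

/-- The testing form of the `TA` condition. -/
def StarCond (n : ℕ) (p s r q : ℝ) (K : ℝ≥0∞) (u v : ((Fin n → ℝ) × ℝ) → ℝ) : Prop :=
  ∀ (x : Fin n → ℝ) (t L : ℝ), 0 < L → ∀ g : ((Fin n → ℝ) × ℝ) → ℝ≥0∞, Measurable g →
    (∀ z, g z ≠ ∞) →
    (∫⁻ z in parLow n p x t L 0, ENNReal.ofReal (u z) ^ q) *
        (∫⁻ z in parUp n p x t L 0, g z) ^ q ≤
      K * (pVol n p L ^ s) ^ q *
        (∫⁻ z in parUp n p x t L 0, g z ^ r * ENNReal.ofReal (v z) ^ r) ^ (q / r)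

theorem weak_integrable (n : ℕ) (p s r q : ℝ) (hp : 1 < p) (hs : 0 < s) (hr : 1 ≤ r) (hrq : r ≤ q)
    (u v : ((Fin n → ℝ) × ℝ) → ℝ) (hv : Measurable v)
    (K : ℝ≥0∞) (hstar : StarCond n p s r q K u v)
    (g : ((Fin n → ℝ) × ℝ) → ℝ≥0∞) (hg : Measurable g) (hgi : ∫⁻ z, g z ≠ ∞)
    (hgf : ∀ z, g z ≠ ∞) (a : ℝ≥0∞) (ha0 : a ≠ 0) (hat : a ≠ ∞) :
    a ^ q * ∫⁻ z in {z | ∃ L : ℝ, 0 < L ∧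
        a * pVol n p L ^ s < ∫⁻ w in parUp n p z.1 z.2 L 0, g w}, ENNReal.ofReal (u z) ^ q ≤
      (4 ^ q * K * kap n p s 3 ^ q * (4 * kap n p s 5) ^ (q / r)) *
        (∫⁻ z, g z ^ r * ENNReal.ofReal (v z) ^ r) ^ (q / r) := by
  have hr0 : 0 < r := by linarith
  have hq0 : 0 < q := by linarith
  have hqr : 1 ≤ q / r := by rwa [le_div_iff₀ hr0, one_mul]
  obtain ⟨S, l, τ, F, hcount, hlpos, hFm, hFsub, hcov, hmass, hover⟩ :=
    cover_lemma n p s hp hs g hg hgi a ha0 hat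
  have : Countable S := hcount.to_subtype
  set h : ((Fin n → ℝ) × ℝ) → ℝ≥0∞ := fun z => g z ^ r * ENNReal.ofReal (v z) ^ r with hh
  have hhm : Measurable h := (hg.pow_const r).mul (hv.ennreal_ofReal.pow_const r)
  have hloc : ∀ b ∈ S, a ^ q * ∫⁻ z in parLow n p b.1 (τ b) (3 * l b) 0, ENNReal.ofReal (u z) ^ q ≤
      (4 ^ q * K * kap n p s 3 ^ q) * (∫⁻ z in F b, h z) ^ (q / r) := by
    intro b hb
    have hl := hlpos b hb
    have h1 := hstar b.1 (τ b) (3 * l b) (by linarith) ((F b).indicator g) (hg.indicator (hFm b hb))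
      (fun z => by by_cases hz : z ∈ F b <;> simp [hz, hgf z])
    have e1 : ∫⁻ z in parUp n p b.1 (τ b) (3 * l b) 0, (F b).indicator g z = ∫⁻ z in F b, g z := by
      rw [setLIntegral_indicator (hFm b hb), inter_eq_left.2 (hFsub b hb)]
    have e2 : ∫⁻ z in parUp n p b.1 (τ b) (3 * l b) 0,
        (F b).indicator g z ^ r * ENNReal.ofReal (v z) ^ r = ∫⁻ z in F b, h z := by
      rw [← inter_eq_left.2 (hFsub b hb), ← setLIntegral_indicator (hFm b hb)]
      refine lintegral_congr fun z => ?_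
      rw [inter_eq_left.2 (hFsub b hb)]
      by_cases hz : z ∈ F b <;> simp [hz, hh, hr0]
    rw [e1, e2, pVol_rpow_scale n p s 3 _ hs.le (by norm_num) hl,
      ENNReal.mul_rpow_of_nonneg _ _ hq0.le] at h1
    set W := pVol n p (l b) ^ s with hW
    have hW0 : W ^ q ≠ 0 := by
      intro h0
      rw [ENNReal.rpow_eq_zero_iff] at h0
      have := pVol_rpow_ne_zero n p s _ hl
      have := pVol_rpow_ne_top n p s _ hl
      simp_all
    have hWt : W ^ q ≠ ∞ := ENNReal.rpow_ne_top_of_nonneg hq0.le (pVol_rpow_ne_top n p s _ hl)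
    set U := ∫⁻ z in parLow n p b.1 (τ b) (3 * l b) 0, ENNReal.ofReal (u z) ^ q with hU
    have h2 : (a * W) ^ q ≤ (4 * ∫⁻ z in F b, g z) ^ q :=
      ENNReal.rpow_le_rpow (hmass b hb) hq0.le
    rw [ENNReal.mul_rpow_of_nonneg _ _ hq0.le, ENNReal.mul_rpow_of_nonneg _ _ hq0.le] at h2
    refine (ENNReal.mul_le_mul_iff_right hW0 hWt).1 ?_
    calc W ^ q * (a ^ q * U) = (a ^ q * W ^ q) * U := by ring
      _ ≤ (4 ^ q * (∫⁻ z in F b, g z) ^ q) * U := by gcongr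
      _ = 4 ^ q * (U * (∫⁻ z in F b, g z) ^ q) := by ring
      _ ≤ 4 ^ q * (K * (kap n p s 3 ^ q * W ^ q) * (∫⁻ z in F b, h z) ^ (q / r)) := by gcongr
      _ = _ := by ring
  have hsum : ∑' b : S, ∫⁻ z in F b, h z ≤ (4 * kap n p s 5) * ∫⁻ z, h z := by
    calc ∑' b : S, ∫⁻ z in F b, h z
        = ∑' b : S, ∫⁻ z, (F b).indicator (fun _ => (1 : ℝ≥0∞)) z * h z := by
          refine tsum_congr fun b => ?_
          rw [← lintegral_indicator (hFm b b.2)]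
          refine lintegral_congr fun z => ?_
          by_cases hz : z ∈ F b <;> simp [hz]
      _ = ∫⁻ z, (∑' b : S, (F b).indicator (fun _ => (1 : ℝ≥0∞)) z) * h z := by
          rw [← lintegral_tsum]
          · exact lintegral_congr fun z => ENNReal.tsum_mul_right
          · exact fun b => ((measurable_const.indicator (hFm b b.2)).mul hhm).aemeasurable
      _ ≤ ∫⁻ z, (4 * kap n p s 5) * h z := by
          refine lintegral_mono fun z => ?_
          gcongr
          exact hover z
      _ = _ := lintegral_const_mul _ hhm
  rw [biUnion_eq_iUnion] at hcov
  calc a ^ q * ∫⁻ z in {z | ∃ L : ℝ, 0 < L ∧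
        a * pVol n p L ^ s < ∫⁻ w in parUp n p z.1 z.2 L 0, g w}, ENNReal.ofReal (u z) ^ q
      ≤ a ^ q * ∑' b : S, ∫⁻ z in parLow n p b.1.1 (τ b) (3 * l b) 0, ENNReal.ofReal (u z) ^ q := by
        gcongr
        exact (lintegral_mono_set hcov).trans (lintegral_iUnion_le _ _)
    _ = ∑' b : S, a ^ q *
          ∫⁻ z in parLow n p b.1.1 (τ b) (3 * l b) 0, ENNReal.ofReal (u z) ^ q :=
        ENNReal.tsum_mul_left.symm
    _ ≤ ∑' b : S, (4 ^ q * K * kap n p s 3 ^ q) * (∫⁻ z in F b, h z) ^ (q / r) :=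
        ENNReal.tsum_le_tsum fun b => hloc b b.2
    _ = (4 ^ q * K * kap n p s 3 ^ q) * ∑' b : S, (∫⁻ z in F b, h z) ^ (q / r) :=
        ENNReal.tsum_mul_left
    _ ≤ (4 ^ q * K * kap n p s 3 ^ q) * ((4 * kap n p s 5) * ∫⁻ z, h z) ^ (q / r) := by
        gcongr
        exact (tsum_rpow_le_rpow_tsum _ _ hqr).trans (ENNReal.rpow_le_rpow hsum (by positivity))
    _ = _ := by
        rw [ENNReal.mul_rpow_of_nonneg _ _ (by positivity)]
        ring

theorem weak_general (n : ℕ) (p s r q : ℝ) (hp : 1 < p) (hs : 0 < s) (hr : 1 ≤ r) (hrq : r ≤ q)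
    (u v : ((Fin n → ℝ) × ℝ) → ℝ) (hv : Measurable v)
    (K : ℝ≥0∞) (hstar : StarCond n p s r q K u v)
    (g : ((Fin n → ℝ) × ℝ) → ℝ≥0∞) (hg : Measurable g)
    (hgf : ∀ z, g z ≠ ∞) (a : ℝ≥0∞) (ha0 : a ≠ 0) (hat : a ≠ ∞) :
    a ^ q * ∫⁻ z in {z | ∃ L : ℝ, 0 < L ∧
        a * pVol n p L ^ s < ∫⁻ w in parUp n p z.1 z.2 L 0, g w}, ENNReal.ofReal (u z) ^ q ≤
      (4 ^ q * K * kap n p s 3 ^ q * (4 * kap n p s 5) ^ (q / r)) *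
        (∫⁻ z, g z ^ r * ENNReal.ofReal (v z) ^ r) ^ (q / r) := by
  have hr0 : 0 < r := by linarith
  have hq0 : 0 < q := by linarith
  set B : ℕ → Set ((Fin n → ℝ) × ℝ) := fun k => Metric.closedBall 0 k with hB
  have hBm : ∀ k, MeasurableSet (B k) := fun k => Metric.isClosed_closedBall.measurableSet
  set G : ℕ → ((Fin n → ℝ) × ℝ) → ℝ≥0∞ := fun k => (B k).indicator (fun z => min (g z) k) with hG
  have hGm : ∀ k, Measurable (G k) := fun k => (hg.min measurable_const).indicator (hBm k)
  have hGle : ∀ k z, G k z ≤ g z := by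
    intro k z
    by_cases hz : z ∈ B k <;> simp [hG, hz]
  have hGmono : Monotone G := by
    intro k k' hkk z
    have hsub : B k ⊆ B k' := Metric.closedBall_subset_closedBall (by exact_mod_cast hkk)
    by_cases hz : z ∈ B k
    · simp only [hG, hz, hsub hz, indicator_of_mem]
      gcongr
    · simp [hG, hz]
  have hGsup : ∀ z, ⨆ k, G k z = g z := by
    intro z
    refine le_antisymm (iSup_le fun k => hGle k z) ?_
    obtain ⟨k1, hk1⟩ := exists_nat_ge (g z).toReal
    obtain ⟨k2, hk2⟩ := exists_nat_ge ‖z‖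
    refine le_iSup_of_le (max k1 k2) ?_
    have hz : z ∈ B (max k1 k2) := by
      simp only [hB, mem_closedBall_zero_iff]
      exact hk2.trans (by exact_mod_cast le_max_right _ _)
    simp only [hG, hz, indicator_of_mem]
    refine le_min le_rfl ?_
    have : g z ≤ (k1 : ℝ≥0∞) := by
      rw [← ENNReal.ofReal_toReal (hgf z), ← ENNReal.ofReal_natCast]
      exact ENNReal.ofReal_le_ofReal hk1
    exact this.trans (by exact_mod_cast le_max_left _ _)
  have hGi : ∀ k, ∫⁻ z, G k z ≠ ∞ := by
    intro k
    refine ne_top_of_le_ne_top ?_ (lintegral_mono (g := (B k).indicator (fun _ => (k : ℝ≥0∞))) ?_)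
    · rw [lintegral_indicator (hBm k), setLIntegral_const]
      exact ENNReal.mul_ne_top (by simp) (measure_closedBall_lt_top).ne
    · intro z
      by_cases hz : z ∈ B k <;> simp [hG, hz]
  set E : (((Fin n → ℝ) × ℝ) → ℝ≥0∞) → Set ((Fin n → ℝ) × ℝ) := fun f => {z | ∃ L : ℝ, 0 < L ∧
        a * pVol n p L ^ s < ∫⁻ w in parUp n p z.1 z.2 L 0, f w} with hE
  have hEU : E g = ⋃ k, E (G k) := by
    ext z
    simp only [hE, mem_setOf_eq, mem_iUnion]
    constructor
    · rintro ⟨L, hL, h⟩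
      have : ∫⁻ w in parUp n p z.1 z.2 L 0, g w = ⨆ k, ∫⁻ w in parUp n p z.1 z.2 L 0, G k w := by
        rw [← lintegral_iSup hGm hGmono]
        exact lintegral_congr fun w => (hGsup w).symm
      rw [this] at h
      obtain ⟨k, hk⟩ := lt_iSup_iff.1 h
      exact ⟨k, L, hL, hk⟩
    · rintro ⟨k, L, hL, h⟩
      exact ⟨L, hL, h.trans_le (lintegral_mono fun w => hGle k w)⟩
  have hEmono : Monotone fun k => E (G k) := by
    intro k k' hkk z
    rintro ⟨L, hL, h⟩
    exact ⟨L, hL, h.trans_le (lintegral_mono fun w => hGmono hkk w)⟩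
  have hmain : ∫⁻ z in E g, ENNReal.ofReal (u z) ^ q
      = ⨆ k, ∫⁻ z in E (G k), ENNReal.ofReal (u z) ^ q := by
    simp only [← withDensity_apply']
    rw [hEU]
    exact hEmono.measure_iUnion
  change a ^ q * ∫⁻ z in E g, ENNReal.ofReal (u z) ^ q ≤ _
  rw [hmain, ENNReal.mul_iSup]
  refine iSup_le fun k => ?_
  refine (weak_integrable n p s r q hp hs hr hrq u v hv K hstar (G k) (hGm k) (hGi k)
    (fun z => ne_top_of_le_ne_top (hgf z) (hGle k z)) a ha0 hat).trans ?_
  gcongr with z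
  exact hGle k z

theorem weak_final (n : ℕ) (p β r q : ℝ) (hp : 1 < p) (hβ : β < 1) (hr : 1 ≤ r) (hrq : r ≤ q)
    (u v : ((Fin n → ℝ) × ℝ) → ℝ) (hv : Measurable v)
    (K : ℝ≥0∞) (hK : K ≠ ∞) (hstar : StarCond n p (1 - β) r q K u v) :
    ∃ C : ℝ, 0 < C ∧ ∀ f : ((Fin n → ℝ) × ℝ) → ℝ, Measurable f → wLp r v f < ∞ →
        wWeak q u (uMax n p 0 β f) ≤ ENNReal.ofReal C * wLp r v f := by
  have hr0 : 0 < r := by linarith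
  have hq0 : 0 < q := by linarith
  have hs : 0 < 1 - β := by linarith
  set s := 1 - β with hsdef
  set M : ℝ≥0∞ := 4 ^ q * K * kap n p s 3 ^ q * (4 * kap n p s 5) ^ (q / r) with hM
  have hMt : M ≠ ∞ := by
    refine ENNReal.mul_ne_top (ENNReal.mul_ne_top (ENNReal.mul_ne_top ?_ hK) ?_) ?_
    · exact ENNReal.rpow_ne_top_of_nonneg hq0.le (by simp)
    · exact ENNReal.rpow_ne_top_of_nonneg hq0.le (kap_ne_top n p s 3 hs.le)
    · exact ENNReal.rpow_ne_top_of_nonneg (by positivity)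
        (ENNReal.mul_ne_top (by simp) (kap_ne_top n p s 5 hs.le))
  set k2 := kap n p s 2 with hk2
  have hk20 : k2 ≠ 0 := kap_ne_zero n p s 2 (by norm_num)
  have hk2t : k2 ≠ ∞ := kap_ne_top n p s 2 hs.le
  set C0 : ℝ≥0∞ := k2 * M ^ (1 / q) with hC0
  have hC0t : C0 ≠ ∞ := ENNReal.mul_ne_top hk2t (ENNReal.rpow_ne_top_of_nonneg (by positivity) hMt)
  refine ⟨C0.toReal + 1, by positivity, fun f hf _ => ?_⟩
  have hCle : C0 ≤ ENNReal.ofReal (C0.toReal + 1) := by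
    conv_lhs => rw [← ENNReal.ofReal_toReal hC0t]
    exact ENNReal.ofReal_le_ofReal (by linarith)
  refine le_trans ?_ (mul_le_mul_left hCle _)
  refine iSup_le fun lam => iSup_le fun hlam => ?_
  set g : ((Fin n → ℝ) × ℝ) → ℝ≥0∞ := fun z => ENNReal.ofReal |f z| with hg
  have hgm : Measurable g := hf.abs.ennreal_ofReal
  set a : ℝ≥0∞ := lam / k2 with ha
  have hlam0 : (lam : ℝ≥0∞) ≠ 0 := by exact_mod_cast hlam.ne'
  have ha0 : a ≠ 0 := ENNReal.div_ne_zero.2 ⟨hlam0, hk2t⟩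
  have hat : a ≠ ∞ := ENNReal.div_ne_top (by simp) hk20
  have hw := weak_general n p s r q hp hs hr hrq u v hv K hstar g hgm (fun z => by simp [hg])
    a ha0 hat
  have hsub : {z | (lam : ℝ≥0∞) < uMax n p 0 β f z} ⊆ {z | ∃ L : ℝ, 0 < L ∧
        a * pVol n p L ^ s < ∫⁻ w in parUp n p z.1 z.2 L 0, g w} := by
    intro z hz
    simp only [mem_setOf_eq, uMax, lt_iSup_iff] at hz
    obtain ⟨x, t, L, hL, hzR, hlt⟩ := hz
    refine ⟨2 * L, by linarith, ?_⟩
    rw [pVol_rpow_scale n p s 2 L hs.le (by norm_num) hL, ← mul_assoc, ha,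
      ENNReal.div_mul_cancel hk20 hk2t]
    have hV0 := pVol_ne_zero n p L hL
    have hVt := pVol_ne_top n p L
    rw [setAvg, volume_parUp0 n p x t L hL] at hlt
    have h1 : (lam : ℝ≥0∞) * pVol n p L ^ s < ∫⁻ w in parUp n p x t L 0, g w := by
      have h2 := ENNReal.mul_lt_mul_left (pVol_rpow_ne_zero n p s L hL)
        (pVol_rpow_ne_top n p s L hL) hlt
      refine h2.trans_le (le_of_eq ?_)
      have : pVol n p L ^ β * pVol n p L ^ s = pVol n p L := by
        rw [← ENNReal.rpow_add _ _ hV0 hVt, hsdef]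
        simp
      calc pVol n p L ^ β * ((∫⁻ w in parUp n p x t L 0, g w) / pVol n p L) * pVol n p L ^ s
          = (pVol n p L ^ β * pVol n p L ^ s) *
            ((∫⁻ w in parUp n p x t L 0, g w) / pVol n p L) := by ring
        _ = _ := by rw [this, ENNReal.mul_div_cancel hV0 hVt]
    refine h1.trans_le (lintegral_mono_set ?_)
    intro w hwR
    obtain ⟨a1, a2, a3⟩ := mem_parLow0.1 hzR
    obtain ⟨b1, b2, b3⟩ := mem_parUp0.1 hwR
    have h2p : 2 * L ^ p ≤ (2 * L) ^ p := by
      rw [Real.mul_rpow (by norm_num) hL.le]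
      have : (2 : ℝ) ≤ 2 ^ p := by
        conv_lhs => rw [← Real.rpow_one (2 : ℝ)]
        exact Real.rpow_le_rpow_of_exponent_le (by norm_num) hp.le
      have : 0 < L ^ p := by positivity
      nlinarith
    refine mem_parUp0.2 ⟨?_, by linarith, by linarith⟩
    have e : w.1 - z.1 = (w.1 - x) - (z.1 - x) := by abel
    rw [e]
    linarith [norm_sub_le (w.1 - x) (z.1 - x)]
  have hqq : ∀ y : ℝ≥0∞, (y ^ q) ^ (1 / q) = y := by
    intro y
    rw [← ENNReal.rpow_mul, mul_one_div_cancel hq0.ne', ENNReal.rpow_one]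
  have h3 := ENNReal.rpow_le_rpow hw (by positivity : (0 : ℝ) ≤ 1 / q)
  rw [ENNReal.mul_rpow_of_nonneg _ _ (by positivity), hqq,
    ENNReal.mul_rpow_of_nonneg _ _ (by positivity), ← ENNReal.rpow_mul,
    show q / r * (1 / q) = 1 / r by field_simp] at h3
  calc (lam : ℝ≥0∞) * (∫⁻ z in {z | (lam : ℝ≥0∞) < uMax n p 0 β f z},
        ENNReal.ofReal (u z) ^ q) ^ (1 / q)
      ≤ (lam : ℝ≥0∞) * (∫⁻ z in {z | ∃ L : ℝ, 0 < L ∧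
        a * pVol n p L ^ s < ∫⁻ w in parUp n p z.1 z.2 L 0, g w},
        ENNReal.ofReal (u z) ^ q) ^ (1 / q) := by
        gcongr
    _ = k2 * (a * (∫⁻ z in {z | ∃ L : ℝ, 0 < L ∧
        a * pVol n p L ^ s < ∫⁻ w in parUp n p z.1 z.2 L 0, g w},
        ENNReal.ofReal (u z) ^ q) ^ (1 / q)) := by
        rw [← mul_assoc, ha, ENNReal.mul_div_cancel hk20 hk2t]
    _ ≤ k2 * (M ^ (1 / q) *
        (∫⁻ z, g z ^ r * ENNReal.ofReal (v z) ^ r) ^ (1 / r)) := by gcongr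
    _ = C0 * wLp r v f := by
        rw [hC0, wLp, mul_assoc]


theorem avg_norm (P U S K : ℝ≥0∞) (a : ℝ) (ha : 0 ≤ a) (hP0 : P ≠ 0) (hPt : P ≠ ∞) :
    U / P * (S / P) ^ a ≤ K ↔ U * S ^ a ≤ K * P ^ (1 + a) := by
  have h1 : U / P * (S / P) ^ a = U * S ^ a / P ^ (1 + a) := by
    rw [ENNReal.div_rpow_of_nonneg _ _ ha, ENNReal.rpow_add _ _ hP0 hPt, ENNReal.rpow_one,
      ENNReal.div_eq_inv_mul, ENNReal.div_eq_inv_mul, ENNReal.div_eq_inv_mul,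
      ENNReal.mul_inv (Or.inl hP0) (Or.inl hPt)]
    ring
  rw [h1, ENNReal.div_le_iff]
  · simp [ENNReal.rpow_eq_zero_iff, hP0, hPt]
  · simp [ENNReal.rpow_eq_top_iff, hP0, hPt]

theorem expo_eq (r q β : ℝ) (hr : 1 < r) (hrq : r ≤ q) (hβ : β = 1 / r - 1 / q) :
    1 + q / (r / (r - 1)) = (1 - β) * q := by
  have : r - 1 ≠ 0 := by linarith
  have : r ≠ 0 := by linarith
  have : q ≠ 0 := by linarith
  subst hβ
  field_simp
  ring

theorem absA {α : Type*} [MeasurableSpace α] (μ : Measure α) (V g : α → ℝ≥0∞)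
    (hV : Measurable V) (hVt : ∀ z, V z ≠ ∞) (hg : Measurable g)
    (r q : ℝ) (hr : 1 < r) (hrq : r ≤ q) (U W : ℝ≥0∞) (hW : W ≠ ∞)
    (h : U * (∫⁻ z, V z ^ (-(r / (r - 1))) ∂μ) ^ (q / (r / (r - 1))) ≤ W) :
    U * (∫⁻ z, g z ∂μ) ^ q ≤ W * (∫⁻ z, g z ^ r * V z ^ r ∂μ) ^ (q / r) := by
  have hr0 : 0 < r := by linarith
  have hq0 : 0 < q := by linarith
  set r' := r / (r - 1) with hr'
  have hr'0 : 0 < r' := div_pos hr0 (by linarith)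
  have hconj : r.HolderConjugate r' := Real.HolderConjugate.conjExponent hr
  by_cases hU : U = 0
  · simp [hU]
  have hσ : ∫⁻ z, V z ^ (-r') ∂μ ≠ ∞ := by
    intro hs
    rw [hs, ENNReal.top_rpow_of_pos (by positivity), ENNReal.mul_top hU] at h
    exact hW (top_le_iff.1 h)
  have hae : ∀ᵐ z ∂μ, V z ≠ 0 := by
    filter_upwards [ae_lt_top (hV.pow_const _) hσ] with z hz h0
    rw [h0, ENNReal.zero_rpow_of_neg (by linarith)] at hz
    exact lt_irrefl _ hz
  have hH := ENNReal.lintegral_mul_le_Lp_mul_Lq μ hconj (f := fun z => g z * V z)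
    (g := fun z => (V z)⁻¹) (hg.mul hV).aemeasurable hV.inv.aemeasurable
  have e1 : ∫⁻ z, ((fun z => g z * V z) * fun z => (V z)⁻¹) z ∂μ = ∫⁻ z, g z ∂μ := by
    refine lintegral_congr_ae ?_
    filter_upwards [hae] with z hz
    simp only [Pi.mul_apply]
    rw [mul_assoc, ENNReal.mul_inv_cancel hz (hVt z), mul_one]
  have e2 : ∫⁻ z, (g z * V z) ^ r ∂μ = ∫⁻ z, g z ^ r * V z ^ r ∂μ :=
    lintegral_congr fun z => ENNReal.mul_rpow_of_nonneg _ _ hr0.le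
  have e3 : ∫⁻ z, (V z)⁻¹ ^ r' ∂μ = ∫⁻ z, V z ^ (-r') ∂μ :=
    lintegral_congr fun z => by rw [ENNReal.inv_rpow, ENNReal.rpow_neg]
  rw [e1, e2, e3] at hH
  calc U * (∫⁻ z, g z ∂μ) ^ q
      ≤ U * ((∫⁻ z, g z ^ r * V z ^ r ∂μ) ^ (1 / r) * (∫⁻ z, V z ^ (-r') ∂μ) ^ (1 / r')) ^ q := by
        gcongr
    _ = (U * (∫⁻ z, V z ^ (-r') ∂μ) ^ (q / r')) * (∫⁻ z, g z ^ r * V z ^ r ∂μ) ^ (q / r) := by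
        rw [ENNReal.mul_rpow_of_nonneg _ _ hq0.le, ← ENNReal.rpow_mul, ← ENNReal.rpow_mul,
          show 1 / r * q = q / r by ring, show 1 / r' * q = q / r' by ring]
        ring
    _ ≤ _ := by gcongr

theorem absA1 {α : Type*} [MeasurableSpace α] (μ : Measure α) (hμ : μ ≠ 0) (V g : α → ℝ≥0∞)
    (hV : Measurable V) (hVt : ∀ z, V z ≠ ∞)
    (q : ℝ) (hq : 1 ≤ q) (U W : ℝ≥0∞) (hW : W ≠ ∞)
    (h : U * (essInf V μ) ^ (-q) ≤ W) :
    U * (∫⁻ z, g z ∂μ) ^ q ≤ W * (∫⁻ z, g z * V z ∂μ) ^ q := by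
  have hq0 : 0 < q := by linarith
  by_cases hU : U = 0
  · simp [hU]
  set m := essInf V μ with hm
  have hm0 : m ≠ 0 := by
    intro h0
    rw [h0, ENNReal.zero_rpow_of_neg (by linarith), ENNReal.mul_top hU] at h
    exact hW (top_le_iff.1 h)
  have hae : ∀ᵐ z ∂μ, m ≤ V z := ae_essInf_le
  have hmt : m ≠ ∞ := by
    intro ht
    have : ∀ᵐ z ∂μ, False := by
      filter_upwards [hae] with z hz
      exact hVt z (top_le_iff.1 (ht ▸ hz))
    simp at this
    exact hμ this
  have hU2 : U ≤ W * m ^ q := by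
    rw [ENNReal.rpow_neg, ← div_eq_mul_inv] at h
    rwa [ENNReal.div_le_iff] at h
    · simp [ENNReal.rpow_eq_zero_iff, hm0, hmt]
    · simp [ENNReal.rpow_eq_top_iff, hm0, hmt]
  calc U * (∫⁻ z, g z ∂μ) ^ q ≤ W * m ^ q * (∫⁻ z, g z ∂μ) ^ q := by gcongr
    _ = W * (m * ∫⁻ z, g z ∂μ) ^ q := by
        rw [ENNReal.mul_rpow_of_nonneg _ _ hq0.le, mul_assoc]
    _ ≤ _ := by
        gcongr
        rw [← lintegral_const_mul' _ _ hmt]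
        refine lintegral_mono_ae ?_
        filter_upwards [hae] with z hz
        rw [mul_comm]
        gcongr

theorem absD {α : Type*} [MeasurableSpace α] (μ : Measure α) [IsFiniteMeasure μ] (V : α → ℝ≥0∞)
    (hV : Measurable V) (hVt : ∀ z, V z ≠ ∞)
    (r q : ℝ) (hr : 1 < r) (hrq : r ≤ q) (U W : ℝ≥0∞)
    (h : ∀ g : α → ℝ≥0∞, Measurable g → (∀ z, g z ≠ ∞) →
      U * (∫⁻ z, g z ∂μ) ^ q ≤ W * (∫⁻ z, g z ^ r * V z ^ r ∂μ) ^ (q / r)) :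
    U * (∫⁻ z, V z ^ (-(r / (r - 1))) ∂μ) ^ (q / (r / (r - 1))) ≤ W := by
  have hr0 : 0 < r := by linarith
  have hq0 : 0 < q := by linarith
  set r' := r / (r - 1) with hr'
  have hr1 : r - 1 ≠ 0 := by linarith
  have hr'0 : 0 < r' := div_pos hr0 (by linarith)
  have ha : 0 < q / r' := by positivity
  set g : ℕ → α → ℝ≥0∞ := fun k z => (V z + ((k : ℝ≥0∞) + 1)⁻¹) ^ (-r') with hg
  have hgm : ∀ k, Measurable (g k) := fun k => (hV.add_const _).pow_const _
  have hε0 : ∀ k : ℕ, ((k : ℝ≥0∞) + 1)⁻¹ ≠ 0 := fun k =>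
    ENNReal.inv_ne_zero.2 (by finiteness)
  have hεt : ∀ k : ℕ, ((k : ℝ≥0∞) + 1)⁻¹ ≠ ∞ := fun k =>
    ENNReal.inv_ne_top.2 (by simp)
  have hb0 : ∀ (k : ℕ) z, V z + ((k : ℝ≥0∞) + 1)⁻¹ ≠ 0 := fun k z h0 => hε0 k (add_eq_zero.1 h0).2
  have hbt : ∀ (k : ℕ) z, V z + ((k : ℝ≥0∞) + 1)⁻¹ ≠ ∞ := fun k z =>
    ENNReal.add_ne_top.2 ⟨hVt z, hεt k⟩
  have hgt : ∀ k z, g k z ≠ ∞ := fun k z => by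
    simp only [hg]
    exact ENNReal.rpow_ne_top_of_ne_zero (hb0 k z) (hbt k z)
  have hgle : ∀ k z, g k z ≤ (((k : ℝ≥0∞) + 1)⁻¹) ^ (-r') := fun k z => by
    simp only [hg, ENNReal.rpow_neg]
    gcongr
    exact le_add_self
  have hgrV : ∀ k z, g k z ^ r * V z ^ r ≤ g k z := fun k z => by
    calc g k z ^ r * V z ^ r ≤ g k z ^ r * (V z + ((k : ℝ≥0∞) + 1)⁻¹) ^ r := by
          gcongr; exact le_self_add
      _ = g k z := by
          simp only [hg]
          rw [← ENNReal.rpow_mul, ← ENNReal.rpow_add _ _ (hb0 k z) (hbt k z)]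
          congr 1
          rw [hr']; field_simp; ring
  have hI : ∀ k, U * (∫⁻ z, g k z ∂μ) ^ (q / r') ≤ W := by
    intro k
    have h1 := h (g k) (hgm k) (hgt k)
    have h2 : U * (∫⁻ z, g k z ∂μ) ^ q ≤ W * (∫⁻ z, g k z ∂μ) ^ (q / r) :=
      h1.trans (by gcongr with z; exact hgrV k z)
    have hIt : ∫⁻ z, g k z ∂μ ≠ ∞ := by
      have : ∫⁻ z, g k z ∂μ ≤ ∫⁻ z, (((k : ℝ≥0∞) + 1)⁻¹) ^ (-r') ∂μ :=
        lintegral_mono (hgle k)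
      rw [lintegral_const] at this
      exact ne_top_of_le_ne_top (ENNReal.mul_ne_top
        (ENNReal.rpow_ne_top_of_ne_zero (hε0 k) (hεt k)) (measure_ne_top _ _)) this
    by_cases hI0 : ∫⁻ z, g k z ∂μ = 0
    · rw [hI0, ENNReal.zero_rpow_of_pos ha]; simp
    have hx0 : (∫⁻ z, g k z ∂μ) ^ (q / r) ≠ 0 := by simp [ENNReal.rpow_eq_zero_iff, hI0, hIt]
    have hxt : (∫⁻ z, g k z ∂μ) ^ (q / r) ≠ ∞ := ENNReal.rpow_ne_top_of_ne_zero hI0 hIt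
    have e : q = q / r' + q / r := by rw [hr']; field_simp; ring
    rw [e, ENNReal.rpow_add _ _ hI0 hIt, ← mul_assoc, ← e] at h2
    rwa [mul_comm _ ((∫⁻ z, g k z ∂μ) ^ (q / r)), mul_comm W,
      ENNReal.mul_le_mul_iff_right hx0 hxt] at h2
  have hmono : Monotone g := by
    intro i j hij z
    simp only [hg, ENNReal.rpow_neg]
    gcongr
  have hsup : ∀ z, ⨆ k, g k z = V z ^ (-r') := by
    intro z
    have ht : Filter.Tendsto (fun k : ℕ => g k z) Filter.atTop (nhds (V z ^ (-r'))) := by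
      have h1 : Filter.Tendsto (fun k : ℕ => V z + ((k : ℝ≥0∞) + 1)⁻¹) Filter.atTop
          (nhds (V z)) := by
        have h3 : Filter.Tendsto (fun k : ℕ => (((k + 1 : ℕ) : ℝ≥0∞))⁻¹) Filter.atTop (nhds 0) :=
          (Filter.tendsto_add_atTop_iff_nat 1).2 ENNReal.tendsto_inv_nat_nhds_zero
        have := (tendsto_const_nhds (x := V z)).add h3
        simpa using this
      exact ((ENNReal.continuous_rpow_const (y := -r')).tendsto _).comp h1
    exact iSup_eq_of_tendsto (fun i j hij => hmono hij z) ht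
  have hconv : Filter.Tendsto (fun k => ∫⁻ z, g k z ∂μ) Filter.atTop
      (nhds (∫⁻ z, V z ^ (-r') ∂μ)) := by
    have e : ∫⁻ z, V z ^ (-r') ∂μ = ⨆ k, ∫⁻ z, g k z ∂μ := by
      rw [← lintegral_iSup hgm hmono]
      exact lintegral_congr fun z => (hsup z).symm
    rw [e]
    exact tendsto_atTop_iSup fun i j hij => lintegral_mono (hmono hij)
  by_cases hU : U = 0
  · simp [hU]
  have e : (∫⁻ z, V z ^ (-r') ∂μ) ^ (q / r') = ⨆ k, (∫⁻ z, g k z ∂μ) ^ (q / r') := by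
    refine (iSup_eq_of_tendsto (fun i j hij =>
      ENNReal.rpow_le_rpow (lintegral_mono (hmono hij)) ha.le) ?_).symm
    exact ((ENNReal.continuous_rpow_const (y := q / r')).tendsto _).comp hconv
  rw [e, ENNReal.mul_iSup]
  exact iSup_le hI

theorem absD1 {α : Type*} [MeasurableSpace α] (μ : Measure α) [IsFiniteMeasure μ]
    (V : α → ℝ≥0∞)
    (hV : Measurable V)
    (q : ℝ) (hq : 1 ≤ q) (U W : ℝ≥0∞) (hW : W ≠ ∞)
    (h : ∀ g : α → ℝ≥0∞, Measurable g → (∀ z, g z ≠ ∞) →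
      U * (∫⁻ z, g z ∂μ) ^ q ≤ W * (∫⁻ z, g z * V z ∂μ) ^ q) :
    U * (essInf V μ) ^ (-q) ≤ W := by
  have hq0 : 0 < q := by linarith
  set m := essInf V μ with hm
  by_cases hmt : m = ∞
  · rw [hmt, ENNReal.top_rpow_of_neg (by linarith)]; simp
  have key : ∀ a : ℝ≥0∞, m < a → U ≤ W * a ^ q := by
    intro a ha
    have hE : μ {z | V z < a} ≠ 0 := by
      intro h0
      have h1 : ∀ᵐ z ∂μ, a ≤ V z := by
        rw [ae_iff]
        simpa using h0
      exact absurd (le_essInf_of_ae_le a h1) (not_le.2 ha)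
    have hEm : MeasurableSet {z | V z < a} := measurableSet_lt hV measurable_const
    have h1 := h ({z | V z < a}.indicator fun _ => (1 : ℝ≥0∞)) (measurable_const.indicator hEm)
      (fun z => by by_cases hz : z ∈ {z | V z < a} <;> simp [Set.indicator, hz])
    rw [lintegral_indicator hEm, setLIntegral_one] at h1
    have h2 : ∫⁻ z, ({z | V z < a}.indicator (fun _ => (1 : ℝ≥0∞)) z) * V z ∂μ
        ≤ a * μ {z | V z < a} := by
      calc _ ≤ ∫⁻ z, {z | V z < a}.indicator (fun _ => a) z ∂μ := by
            refine lintegral_mono fun z => ?_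
            by_cases hz : V z < a
            · simp [Set.indicator, hz, hz.le]
            · simp [Set.indicator, hz]
        _ = _ := by rw [lintegral_indicator_const hEm]
    have h3 : U * μ {z | V z < a} ^ q ≤ W * a ^ q * μ {z | V z < a} ^ q := by
      refine h1.trans ?_
      rw [mul_assoc, ← ENNReal.mul_rpow_of_nonneg _ _ hq0.le]
      gcongr
    have hEt : μ {z | V z < a} ≠ ∞ := measure_ne_top _ _
    rw [mul_comm U, mul_comm (W * a ^ q), ENNReal.mul_le_mul_iff_right] at h3
    · exact h3
    · simp [ENNReal.rpow_eq_zero_iff, hE, hEt]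
    · exact ENNReal.rpow_ne_top_of_ne_zero hE hEt
  have hUm : U ≤ W * m ^ q := by
    have hc : Filter.Tendsto (fun a : ℝ≥0∞ => W * a ^ q) (nhdsWithin m (Set.Ioi m))
        (nhds (W * m ^ q)) := by
      refine Filter.Tendsto.mono_left ?_ nhdsWithin_le_nhds
      exact ENNReal.Tendsto.const_mul ((ENNReal.continuous_rpow_const (y := q)).tendsto m)
        (Or.inr hW)
    have : (nhdsWithin m (Set.Ioi m)).NeBot := by
      apply nhdsGT_neBot_of_exists_gt
      exact ⟨∞, lt_top_iff_ne_top.2 hmt⟩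
    exact ge_of_tendsto hc (by filter_upwards [self_mem_nhdsWithin] with a ha using key a ha)
  by_cases hm0 : m = 0
  · rw [hm0, ENNReal.zero_rpow_of_pos hq0, mul_zero] at hUm
    rw [le_zero_iff.1 hUm]; simp
  rw [ENNReal.rpow_neg, ← div_eq_mul_inv, ENNReal.div_le_iff]
  · exact hUm
  · simp [ENNReal.rpow_eq_zero_iff, hm0, hmt]
  · exact ENNReal.rpow_ne_top_of_ne_zero hm0 hmt


theorem restrict_parUp0_ne_zero (n : ℕ) (p : ℝ) (x : Fin n → ℝ) (t L : ℝ) (hL : 0 < L) :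
    (volume.restrict (parUp n p x t L 0)) ≠ 0 := by
  intro h
  have h1 := congrArg (fun μ : Measure ((Fin n → ℝ) × ℝ) => μ univ) h
  simp only [Measure.restrict_apply_univ, volume_parUp0 n p x t L hL] at h1
  exact pVol_ne_zero n p L hL (by simpa using h1)

theorem finite_restrict_parUp0 (n : ℕ) (p : ℝ) (x : Fin n → ℝ) (t L : ℝ) (hL : 0 < L) :
    IsFiniteMeasure (volume.restrict (parUp n p x t L 0)) := by
  refine ⟨?_⟩
  rw [Measure.restrict_apply_univ, volume_parUp0 n p x t L hL]
  exact (pVol_ne_top n p L).lt_top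

theorem one_sub_beta_one (β q : ℝ) (hq : 1 ≤ q) (hβ : β = 1 / 1 - 1 / q) : (1 - β) * q = 1 := by
  have : q ≠ 0 := by linarith
  subst hβ
  field_simp
  ring

theorem star_of_TA (n : ℕ) (p β r q : ℝ) (hr : 1 ≤ r) (hrq : r ≤ q) (hβ : β = 1 / r - 1 / q)
    (u v : ((Fin n → ℝ) × ℝ) → ℝ) (hv : Measurable v) (h : TAconst n p 0 r q u v < ∞) :
    StarCond n p (1 - β) r q (TAconst n p 0 r q u v) u v := by
  intro x t L hL g hg hgt
  have hP0 := pVol_ne_zero n p L hL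
  have hPt := pVol_ne_top n p L
  have hW : TAconst n p 0 r q u v * (pVol n p L ^ (1 - β)) ^ q ≠ ∞ := by
    rw [← ENNReal.rpow_mul]
    exact ENNReal.mul_ne_top h.ne (pVol_rpow_ne_top n p _ L hL)
  by_cases hr1 : r = 1
  · subst hr1
    have hle : setAvg (parLow n p x t L 0) (fun z => ENNReal.ofReal (u z) ^ q) *
      (essInf (fun z => ENNReal.ofReal (v z)) (volume.restrict (parUp n p x t L 0))) ^ (-q) ≤
        TAconst n p 0 1 q u v := by
      rw [TAconst, if_pos rfl, TA1q]
      exact le_iSup_of_le x (le_iSup_of_le t (le_iSup_of_le L (le_iSup_of_le hL le_rfl)))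
    have := absA1 (volume.restrict (parUp n p x t L 0)) (restrict_parUp0_ne_zero n p x t L hL)
      (fun z => ENNReal.ofReal (v z)) g hv.ennreal_ofReal (fun _ => ENNReal.ofReal_ne_top) q hrq
      (∫⁻ z in parLow n p x t L 0, ENNReal.ofReal (u z) ^ q) _ hW (by
        rw [← ENNReal.rpow_mul, one_sub_beta_one β q hrq hβ, ENNReal.rpow_one]
        rw [setAvg, volume_parLow0 n p x t L hL, ENNReal.div_eq_inv_mul, mul_assoc,
          mul_comm, ← div_eq_mul_inv, ENNReal.div_le_iff hP0 hPt] at hle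
        exact hle)
    simpa using this
  · have hr' : 1 < r := lt_of_le_of_ne hr (Ne.symm hr1)
    have hle : setAvg (parLow n p x t L 0) (fun z => ENNReal.ofReal (u z) ^ q) *
      (setAvg (parUp n p x t L 0)
          (fun z => ENNReal.ofReal (v z) ^ (-(r / (r - 1))))) ^ (q / (r / (r - 1))) ≤
        TAconst n p 0 r q u v := by
      rw [TAconst, if_neg hr1, TArq]
      exact le_iSup_of_le x (le_iSup_of_le t (le_iSup_of_le L (le_iSup_of_le hL le_rfl)))
    have ha : 0 ≤ q / (r / (r - 1)) := div_nonneg (by linarith)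
      (div_nonneg (by linarith) (by linarith))
    rw [setAvg, setAvg, volume_parLow0 n p x t L hL, volume_parUp0 n p x t L hL,
      avg_norm _ _ _ _ _ ha hP0 hPt, expo_eq r q β hr' hrq hβ, ENNReal.rpow_mul] at hle
    exact absA (volume.restrict (parUp n p x t L 0)) (fun z => ENNReal.ofReal (v z)) g
      hv.ennreal_ofReal (fun _ => ENNReal.ofReal_ne_top) hg r q hr' hrq _ _ hW hle

theorem TA_of_star (n : ℕ) (p β r q : ℝ) (hr : 1 ≤ r) (hrq : r ≤ q) (hβ : β = 1 / r - 1 / q)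
    (u v : ((Fin n → ℝ) × ℝ) → ℝ) (hv : Measurable v) (K : ℝ≥0∞) (hK : K ≠ ∞)
    (h : StarCond n p (1 - β) r q K u v) : TAconst n p 0 r q u v ≤ K := by
  by_cases hr1 : r = 1
  · subst hr1
    rw [TAconst, if_pos rfl, TA1q]
    refine iSup_le fun x => iSup_le fun t => iSup_le fun L => iSup_le fun hL => ?_
    have hP0 := pVol_ne_zero n p L hL
    have hPt := pVol_ne_top n p L
    have := finite_restrict_parUp0 n p x t L hL
    have h1 := absD1 (volume.restrict (parUp n p x t L 0))
      (fun z => ENNReal.ofReal (v z)) hv.ennreal_ofReal q hrq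
      (∫⁻ z in parLow n p x t L 0, ENNReal.ofReal (u z) ^ q) (K * pVol n p L)
      (ENNReal.mul_ne_top hK hPt) (fun g hg hgt => by
        have h2 := h x t L hL g hg hgt
        rw [← ENNReal.rpow_mul, one_sub_beta_one β q hrq hβ, ENNReal.rpow_one] at h2
        simpa using h2)
    rw [setAvg, volume_parLow0 n p x t L hL, ENNReal.div_eq_inv_mul, mul_assoc,
      mul_comm, ← div_eq_mul_inv, ENNReal.div_le_iff hP0 hPt]
    exact h1
  · have hr' : 1 < r := lt_of_le_of_ne hr (Ne.symm hr1)
    rw [TAconst, if_neg hr1, TArq]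
    refine iSup_le fun x => iSup_le fun t => iSup_le fun L => iSup_le fun hL => ?_
    have hP0 := pVol_ne_zero n p L hL
    have hPt := pVol_ne_top n p L
    have := finite_restrict_parUp0 n p x t L hL
    have ha : 0 ≤ q / (r / (r - 1)) := div_nonneg (by linarith)
      (div_nonneg (by linarith) (by linarith))
    rw [setAvg, setAvg, volume_parLow0 n p x t L hL, volume_parUp0 n p x t L hL,
      avg_norm _ _ _ _ _ ha hP0 hPt, expo_eq r q β hr' hrq hβ, ENNReal.rpow_mul]
    exact absD (volume.restrict (parUp n p x t L 0)) (fun z => ENNReal.ofReal (v z))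
      hv.ennreal_ofReal (fun _ => ENNReal.ofReal_ne_top) r q hr' hrq _ _ (h x t L hL)

theorem star_of_weak (n : ℕ) (p β r q : ℝ) (hr : 1 ≤ r) (hrq : r ≤ q)
    (u v : ((Fin n → ℝ) × ℝ) → ℝ) (C : ℝ) (hC : 0 < C)
    (h : ∀ f : ((Fin n → ℝ) × ℝ) → ℝ, Measurable f → wLp r v f < ∞ →
        wWeak q u (uMax n p 0 β f) ≤ ENNReal.ofReal C * wLp r v f) :
    StarCond n p (1 - β) r q (ENNReal.ofReal C ^ q) u v := by
  intro x t L hL g hg hgt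
  have hr0 : 0 < r := by linarith
  have hq0 : 0 < q := by linarith
  have hC0 : ENNReal.ofReal C ≠ 0 := by simpa using hC
  have hP0 := pVol_ne_zero n p L hL
  have hPt := pVol_ne_top n p L
  have hPm := measurableSet_parUp0 n p x t L
  set P := parUp n p x t L 0 with hPdef
  set U := ∫⁻ z in parLow n p x t L 0, ENNReal.ofReal (u z) ^ q with hU
  set X := ∫⁻ z in P, g z ^ r * ENNReal.ofReal (v z) ^ r with hX
  set I := ∫⁻ z in P, g z with hI
  by_cases hXt : X = ∞
  · rw [hXt, ENNReal.top_rpow_of_pos (by positivity), ENNReal.mul_top]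
    · exact le_top
    · refine mul_ne_zero ?_ ?_
      · simp [ENNReal.rpow_eq_zero_iff, hC0]
      · rw [← ENNReal.rpow_mul]
        exact pVol_rpow_ne_zero n p _ L hL
  set f : ((Fin n → ℝ) × ℝ) → ℝ := fun z => (P.indicator g z).toReal with hf
  have hfm : Measurable f := (hg.indicator hPm).ennreal_toReal
  have hfe : ∀ z, ENNReal.ofReal |f z| = P.indicator g z := by
    intro z
    simp only [hf]
    rw [abs_of_nonneg ENNReal.toReal_nonneg, ENNReal.ofReal_toReal]
    by_cases hz : z ∈ P <;> simp [hz, hgt z]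
  have hwlp : wLp r v f = X ^ (1 / r) := by
    rw [wLp, hX, ← lintegral_indicator hPm]
    congr 1
    refine lintegral_congr fun z => ?_
    rw [hfe z]
    by_cases hz : z ∈ P
    · simp [hz]
    · simp [hz, ENNReal.zero_rpow_of_pos hr0]
  have hw := h f hfm (by
    rw [hwlp]; exact ENNReal.rpow_lt_top_of_nonneg (by positivity) hXt)
  rw [hwlp] at hw
  have hmax : ∀ z ∈ parLow n p x t L 0, pVol n p L ^ β * (I / pVol n p L) ≤ uMax n p 0 β f z := by
    intro z hz
    rw [uMax]
    refine le_iSup_of_le x (le_iSup_of_le t (le_iSup_of_le L (le_iSup_of_le hL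
      (le_iSup_of_le hz ?_))))
    rw [setAvg, volume_parUp0 n p x t L hL]
    refine le_of_eq ?_
    congr 2
    refine setLIntegral_congr_fun hPm fun z hz => ?_
    simp only [hfe z]
    simp [hz]
  set A := pVol n p L ^ β * (I / pVol n p L) with hA
  have hlam : ∀ lam : ℝ≥0∞, lam < A → lam * U ^ (1 / q) ≤ ENNReal.ofReal C * X ^ (1 / r) := by
    intro lam hl
    by_cases hl0 : lam = 0
    · simp [hl0]
    lift lam to ℝ≥0 using hl.ne_top
    refine le_trans ?_ hw
    rw [wWeak]
    refine le_iSup_of_le lam (le_iSup_of_le (pos_iff_ne_zero.2 (by simpa using hl0)) ?_)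
    gcongr
    rw [hU]
    refine lintegral_mono_set fun z hz => ?_
    exact lt_of_lt_of_le hl (hmax z hz)
  have hAle : A * U ^ (1 / q) ≤ ENNReal.ofReal C * X ^ (1 / r) := by
    exact ENNReal.mul_le_of_forall_lt fun a ha b hb =>
      (mul_le_mul_right hb.le a).trans (hlam a ha)
  have hAe : A * pVol n p L ^ (1 - β) = I := by
    rw [hA, ENNReal.rpow_sub _ _ hP0 hPt, ENNReal.rpow_one]
    have hb0 := pVol_rpow_ne_zero n p β L hL
    have hbt := pVol_rpow_ne_top n p β L hL
    calc pVol n p L ^ β * (I / pVol n p L) * (pVol n p L / pVol n p L ^ β)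
        = I * (pVol n p L * (pVol n p L)⁻¹) * (pVol n p L ^ β * (pVol n p L ^ β)⁻¹) := by
          rw [div_eq_mul_inv, div_eq_mul_inv]; ring
      _ = I := by
          rw [ENNReal.mul_inv_cancel hP0 hPt, ENNReal.mul_inv_cancel hb0 hbt, mul_one, mul_one]
  have hfin : I * U ^ (1 / q) ≤ ENNReal.ofReal C * pVol n p L ^ (1 - β) * X ^ (1 / r) := by
    rw [← hAe]
    calc A * pVol n p L ^ (1 - β) * U ^ (1 / q) = (A * U ^ (1 / q)) * pVol n p L ^ (1 - β) := by ring
      _ ≤ (ENNReal.ofReal C * X ^ (1 / r)) * pVol n p L ^ (1 - β) := by gcongr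
      _ = _ := by ring
  have := ENNReal.rpow_le_rpow hfin hq0.le
  rw [ENNReal.mul_rpow_of_nonneg _ _ hq0.le, ENNReal.mul_rpow_of_nonneg _ _ hq0.le,
    ENNReal.mul_rpow_of_nonneg _ _ hq0.le, ← ENNReal.rpow_mul U, ← ENNReal.rpow_mul X,
    one_div_mul_cancel hq0.ne', ENNReal.rpow_one, show 1 / r * q = q / r by ring, mul_comm] at this
  exact this

/-- Weak-type two-weight characterization for the uncentered parabolic fractional
maximal operator `M_β^{0+}` without time lag. -/
theorem TA_weak_type_uncentered_gamma_zero (n : ℕ) (hn : 1 ≤ n) (p : ℝ) (hp : 1 < p)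
    (β r q : ℝ) (hβ : β ∈ Set.Ico (0 : ℝ) 1)
    (hr : 1 ≤ r) (hrq : r ≤ q) (hβrq : β = 1 / r - 1 / q)
    (u v : ((Fin n → ℝ) × ℝ) → ℝ) (hu : Measurable u) (hv : Measurable v)
    (hu0 : ∀ z, 0 ≤ u z) (hv0 : ∀ z, 0 ≤ v z) :
    TAconst n p 0 r q u v < ∞ ↔
      ∃ C : ℝ, 0 < C ∧ ∀ f : ((Fin n → ℝ) × ℝ) → ℝ, Measurable f → wLp r v f < ∞ →
        wWeak q u (uMax n p 0 β f) ≤ ENNReal.ofReal C * wLp r v f := by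
  constructor
  · intro h
    exact weak_final n p β r q hp hβ.2 hr hrq u v hv _ h.ne
      (star_of_TA n p β r q hr hrq hβrq u v hv h)
  · rintro ⟨C, hC, h⟩
    have hK : ENNReal.ofReal C ^ q ≠ ∞ :=
      ENNReal.rpow_ne_top_of_nonneg (by linarith) ENNReal.ofReal_ne_top
    exact lt_of_le_of_lt (TA_of_star n p β r q hr hrq hβrq u v hv _ hK
      (star_of_weak n p β r q hr hrq u v C hC h)) hK.lt_top
end
end
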